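/- arXiv:1305.7004 — 2 statements merged into one kernel-verified Lean document; each statement's English description precedes it below -/
import Mathlib

section
/- Let (R, m) be a complete Noetherian local ring, a an ideal, M a finitely generated R-module, n a nonnegative integer, and t = f^n_a(M) (assumed finite). Then the set { p ∈ Ass_R(⊕_{i=0}^{t-1} H^i_a(M)) : dim R/p ≥ n } is finite. -/
open CategoryTheory

universe u

/-- An `R`-module `M` is *in dimension `< n`* if there is a finitely generated submodule `N`
of `M` such that the Krull dimension of `Supp (M/N)` is `< n`. -/
def InDimLT (R : Type u) [CommRing R] (M : Type u) [AddCommGroup M] [Module R M]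
    (n : ℕ) : Prop :=
  ∃ N : Submodule R M, N.FG ∧
    Order.krullDim (Module.support R (M ⧸ N)) < (n : WithBot ℕ∞)

/-- `f_a(M)`: the least `i` such that `H^i_a(M)` is not finitely generated (`⊤` if none). -/
noncomputable def fDim (R : Type u) [CommRing R] (a : Ideal R)
    (M : Type u) [AddCommGroup M] [Module R M] : ℕ∞ :=
  sInf {i : ℕ∞ | ∃ j : ℕ, i = j ∧
    ¬ Module.Finite R ((localCohomology a j).obj (ModuleCat.of R M))}

/-- `f^n_a(M) = inf { f_{aR_p}(M_p) : p ∈ Supp(M/aM), dim R/p ≥ n }`. -/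
noncomputable def fDimN (R : Type u) [CommRing R] (a : Ideal R)
    (M : Type u) [AddCommGroup M] [Module R M] (n : ℕ) : ℕ∞ :=
  sInf {i : ℕ∞ | ∃ p : PrimeSpectrum R,
    p ∈ Module.support R (M ⧸ (a • ⊤ : Submodule R M)) ∧
    (n : WithBot ℕ∞) ≤ ringKrullDim (R ⧸ p.asIdeal) ∧
    i = fDim (Localization.AtPrime p.asIdeal)
          (a.map (algebraMap R (Localization.AtPrime p.asIdeal)))
          (LocalizedModule p.asIdeal.primeCompl M)}

/-- `h^n_a(M)`: the least `i` such that `H^i_a(M)` is not in dimension `< n` (`⊤` if none). -/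
noncomputable def hDim (R : Type u) [CommRing R] (a : Ideal R)
    (M : Type u) [AddCommGroup M] [Module R M] (n : ℕ) : ℕ∞ :=
  sInf {i : ℕ∞ | ∃ j : ℕ, i = j ∧
    ¬ InDimLT R ((localCohomology a j).obj (ModuleCat.of R M)) n}

namespace AssPrimesFinite

section ExtComparison

open Abelian Limits Opposite

variable {R : Type u} [CommRing R]

lemma extMk_zero_eq_zero_iff {X Y : ModuleCat.{u} R} (P : ProjectiveResolution X)
    (f : P.complex.X 0 ⟶ Y) (hf : P.complex.d 1 0 ≫ f = 0) :
    P.extMk f 1 rfl hf = 0 ↔ f = 0 := by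
  refine ⟨fun h => ?_, fun h => by subst h; simp⟩
  rw [← P.extEquivCohomologyClass.apply_eq_iff_eq, P.extEquivCohomologyClass_extMk,
    P.extEquivCohomologyClass_zero, CochainComplex.HomComplex.CohomologyClass.mk_eq_zero_iff,
    CochainComplex.HomComplex.Cocycle.toSingleMk_mem_coboundaries_iff _ _ _ _ _ 1 (by simp)] at h
  obtain ⟨g, hg⟩ := h
  have hz : IsZero (P.cochainComplex.X 1) := P.cochainComplex.isZero_of_isStrictlyLE 0 1 (by lia)
  rw [hz.eq_of_src g 0, comp_zero] at hg
  rw [← cancel_epi (P.cochainComplexXIso (-(0:ℕ)) 0 rfl).hom, ← hg, comp_zero]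

/-- The cocycle underlying a cycle of the Hom complex of a projective resolution. -/
noncomputable def cyclesToHom (X Y : ModuleCat.{u} R) (P : ProjectiveResolution X) (n : ℕ) :
    (P.complex.linearYonedaObj R Y).cycles n →ₗ[R] (P.complex.X n ⟶ Y) :=
  ((P.complex.linearYonedaObj R Y).iCycles n).hom

/-- The class in `Ext` of a cocycle. -/
noncomputable def cyclesToExt (X Y : ModuleCat.{u} R) (P : ProjectiveResolution X) (n : ℕ) :
    (P.complex.linearYonedaObj R Y).cycles n →ₗ[R] ((_root_.Ext R _ n).obj (.op X)).obj Y :=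
  ((P.complex.linearYonedaObj R Y).homologyπ n ≫ (P.isoExt n Y).inv).hom

lemma cyclesToExt_surjective (X Y : ModuleCat.{u} R) (P : ProjectiveResolution X) (n : ℕ) :
    Function.Surjective (cyclesToExt X Y P n) := by
  apply (ModuleCat.epi_iff_surjective _).1
  infer_instance

lemma cyclesToExt_eq_zero_iff (X Y : ModuleCat.{u} R) (P : ProjectiveResolution X) (n p : ℕ)
    (hp : (ComplexShape.up ℕ).prev n = p) (z) :
    cyclesToExt X Y P n z = 0 ↔ ∃ w, (P.complex.linearYonedaObj R Y).toCycles p n w = z := by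
  have h1 : cyclesToExt X Y P n z = 0 ↔ (P.complex.linearYonedaObj R Y).homologyπ n z = 0 := by
    constructor
    · intro h
      have := congrArg (P.isoExt n Y).hom h
      simpa [cyclesToExt] using this
    · intro h
      simp [cyclesToExt, h]
  rw [h1]
  have := ShortComplex.exact_of_g_is_cokernel
    (.mk _ _ ((P.complex.linearYonedaObj R Y).toCycles_comp_homologyπ p n))
      ((P.complex.linearYonedaObj R Y).homologyIsCokernel p n hp)
  rw [ShortComplex.moduleCat_exact_iff] at this
  refine ⟨this z, ?_⟩
  rintro ⟨w, rfl⟩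
  rw [← ConcreteCategory.comp_apply]
  simp

lemma d_iCycles (X Y : ModuleCat.{u} R) (P : ProjectiveResolution X) (n : ℕ)
    (z : (P.complex.linearYonedaObj R Y).cycles n) :
    P.complex.d (n+1) n ≫ cyclesToHom X Y P n z = 0 := by
  have := ConcreteCategory.congr_hom ((P.complex.linearYonedaObj R Y).iCycles_d n (n+1)) z
  exact this

lemma exists_iCycles (X Y : ModuleCat.{u} R) (P : ProjectiveResolution X) (n : ℕ)
    (f : P.complex.X n ⟶ Y)
    (hf : P.complex.d (n+1) n ≫ f = 0) : ∃ z, cyclesToHom X Y P n z = f := by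
  have := ShortComplex.exact_of_f_is_kernel
    (.mk _ _ ((P.complex.linearYonedaObj R Y).iCycles_d n (n+1)))
      ((P.complex.linearYonedaObj R Y).cyclesIsKernel n (n+1) (by simp))
  rw [ShortComplex.moduleCat_exact_iff] at this
  exact this f hf

/-- The class in `Abelian.Ext` of a cocycle. -/
noncomputable def cyclesToAbelianExt (X Y : ModuleCat.{u} R) (P : ProjectiveResolution X) (n : ℕ) :
    (P.complex.linearYonedaObj R Y).cycles n →ₗ[R] Abelian.Ext X Y n where
  toFun z := P.extMk (cyclesToHom X Y P n z) (n+1) rfl (d_iCycles X Y P n z)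
  map_add' z w := by
    rw [P.add_extMk]
    congr 1
    exact map_add _ _ _
  map_smul' r z := by
    rw [RingHom.id_apply, Abelian.Ext.smul_eq_comp_mk₀, P.extMk_comp_mk₀]
    congr 1
    rw [map_smul, Linear.comp_smul, Category.comp_id]

lemma cyclesToAbelianExt_surjective (X Y : ModuleCat.{u} R) (P : ProjectiveResolution X) (n : ℕ) :
    Function.Surjective (cyclesToAbelianExt X Y P n) := by
  intro α
  obtain ⟨f, hf, rfl⟩ := P.extMk_surjective α (n+1) rfl
  obtain ⟨z, rfl⟩ := exists_iCycles X Y P n f hf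
  exact ⟨z, rfl⟩

lemma ker_cyclesToExt (X Y : ModuleCat.{u} R) (P : ProjectiveResolution X) (n : ℕ) :
    LinearMap.ker (cyclesToExt X Y P n) = LinearMap.ker (cyclesToAbelianExt X Y P n) := by
  ext z
  rw [LinearMap.mem_ker, LinearMap.mem_ker]
  have hi : Function.Injective (cyclesToHom X Y P n) :=
    (ModuleCat.mono_iff_injective _).1 inferInstance
  have ht (p) (w) : cyclesToHom X Y P n ((P.complex.linearYonedaObj R Y).toCycles p n w) =
    P.complex.d n p ≫ w :=
    ConcreteCategory.congr_hom ((P.complex.linearYonedaObj R Y).toCycles_i p n) w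
  cases n with
  | zero =>
    rw [cyclesToExt_eq_zero_iff X Y P 0 0 (by simp)]
    refine Iff.trans ?_ (extMk_zero_eq_zero_iff P _ (d_iCycles X Y P 0 z)).symm
    constructor
    · rintro ⟨w, rfl⟩
      rw [ht, P.complex.shape 0 0 (by simp)]
      exact zero_comp (C := ModuleCat.{u} R)
    · intro h
      refine ⟨0, hi ?_⟩
      rw [h, ht, P.complex.shape 0 0 (by simp)]
      exact zero_comp (C := ModuleCat.{u} R)
  | succ n =>
    rw [cyclesToExt_eq_zero_iff X Y P (n+1) n (by simp)]
    refine Iff.trans ?_ (P.extMk_eq_zero_iff _ _ rfl (d_iCycles X Y P _ z) n rfl).symm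
    constructor
    · rintro ⟨w, rfl⟩
      exact ⟨w, (ht _ _).symm⟩
    · rintro ⟨w, h⟩
      exact ⟨w, hi ((ht _ _).trans h)⟩

lemma isoExt_inv_naturality {X X' : ModuleCat.{u} R} (f : X ⟶ X')
    (P : ProjectiveResolution X) (P' : ProjectiveResolution X')
    (φ : P.complex ⟶ P'.complex) (comm : φ.f 0 ≫ P'.π.f 0 = P.π.f 0 ≫ f)
    (Y : ModuleCat.{u} R) (n : ℕ) :
    (P'.isoExt (R := R) n Y).inv ≫ ((_root_.Ext R (ModuleCat.{u} R) n).map f.op).app Y =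
      HomologicalComplex.homologyMap ((HomologicalComplex.unopFunctor _ _).map
        ((((linearYoneda R _).obj Y).rightOp.mapHomologicalComplex _).map φ).op) n ≫
        (P.isoExt n Y).inv := by
  have h1 := ProjectiveResolution.isoLeftDerivedObj_hom_naturality f P P' φ comm
    ((linearYoneda R _).obj Y).rightOp n
  have h2 := ShortComplex.homologyOpIso_hom_naturality
    ((HomologicalComplex.shortComplexFunctor _ _ n).map ((HomologicalComplex.unopFunctor _ _).map
        ((((linearYoneda R _).obj Y).rightOp.mapHomologicalComplex _).map φ).op))
  apply Quiver.Hom.op_inj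
  have h3 := congrArg (· ≫ (HomologicalComplex.homologyOp
    ((((linearYoneda R _).obj Y).rightOp.mapHomologicalComplex _).obj P'.complex).unop n).hom) h1
  refine (Category.assoc _ _ _).symm.trans (h3.trans ?_)
  refine (Category.assoc _ _ _).trans ?_
  refine Eq.trans ?_ (Category.assoc _ _ _).symm
  exact congrArg (_ ≫ ·) h2

/-- The derived-functor `Ext` agrees with `Abelian.Ext`, via a projective resolution. -/
noncomputable def extEquivOfResolution (X Y : ModuleCat.{u} R) (P : ProjectiveResolution X)
    (n : ℕ) :
    ((_root_.Ext R (ModuleCat.{u} R) n).obj (.op X)).obj Y ≃ₗ[R] Abelian.Ext X Y n :=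
  (LinearMap.quotKerEquivOfSurjective _ (cyclesToExt_surjective X Y P n)).symm ≪≫ₗ
  Submodule.quotEquivOfEq _ _ (ker_cyclesToExt X Y P n) ≪≫ₗ
  (LinearMap.quotKerEquivOfSurjective _ (cyclesToAbelianExt_surjective X Y P n))

lemma extEquivOfResolution_cyclesToExt (X Y : ModuleCat.{u} R) (P : ProjectiveResolution X) (n : ℕ)
    (z) :
    extEquivOfResolution X Y P n (cyclesToExt X Y P n z) = cyclesToAbelianExt X Y P n z := by
  have : (LinearMap.quotKerEquivOfSurjective _ (cyclesToExt_surjective X Y P n)).symm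
    (cyclesToExt X Y P n z) = Submodule.Quotient.mk z := by
    rw [LinearEquiv.symm_apply_eq]; simp
  simp [extEquivOfResolution, this]

lemma extEquivOfResolution_map {X X' : ModuleCat.{u} R} (f : X ⟶ X')
    (P : ProjectiveResolution X) (P' : ProjectiveResolution X') (Y : ModuleCat.{u} R) (n : ℕ)
    (x : ((_root_.Ext R (ModuleCat.{u} R) n).obj (.op X')).obj Y) :
    extEquivOfResolution X Y P n (((_root_.Ext R (ModuleCat.{u} R) n).map f.op).app Y x) =
      (Ext.mk₀ f).comp (extEquivOfResolution X' Y P' n x) (zero_add n) := by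
  obtain ⟨z, rfl⟩ := cyclesToExt_surjective X' Y P' n x
  rw [extEquivOfResolution_cyclesToExt]
  let φ := ProjectiveResolution.lift f P P'
  have comm : φ.f 0 ≫ P'.π.f 0 = P.π.f 0 ≫ f := by
    exact ProjectiveResolution.lift_commutes_zero f P P'
  let ψ : P'.complex.linearYonedaObj R Y ⟶ P.complex.linearYonedaObj R Y :=
    ((HomologicalComplex.unopFunctor _ _).map
        ((((linearYoneda R _).obj Y).rightOp.mapHomologicalComplex _).map φ).op)
  have key : ((_root_.Ext R (ModuleCat.{u} R) n).map f.op).app Y (cyclesToExt X' Y P' n z) =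
      cyclesToExt X Y P n (HomologicalComplex.cyclesMap ψ n z) := by
    have h := isoExt_inv_naturality f P P' φ comm Y n
    have h2 := HomologicalComplex.homologyπ_naturality ψ n
    have h3 : (P'.complex.linearYonedaObj R Y).homologyπ n ≫ (P'.isoExt n Y).inv ≫
      ((_root_.Ext R (ModuleCat.{u} R) n).map f.op).app Y =
       HomologicalComplex.cyclesMap ψ n ≫ (P.complex.linearYonedaObj R Y).homologyπ n ≫
         (P.isoExt n Y).inv := by
      refine (congrArg (_ ≫ ·) h).trans ?_
      refine (Category.assoc _ _ _).symm.trans ?_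
      refine Eq.trans ?_ (Category.assoc _ _ _)
      exact congrArg (· ≫ _) h2
    exact ConcreteCategory.congr_hom h3 z
  rw [key, extEquivOfResolution_cyclesToExt]
  refine Eq.trans ?_ (ProjectiveResolution.mk₀_comp_extMk (R := P') (cyclesToHom X' Y P' n z) (n+1)
    rfl (d_iCycles X' Y P' n z)
    (R' := P) ⟨φ, by simpa using comm⟩).symm
  have h4 : cyclesToHom X Y P n (HomologicalComplex.cyclesMap ψ n z) = φ.f n ≫
    cyclesToHom X' Y P' n z :=
    ConcreteCategory.congr_hom (HomologicalComplex.cyclesMap_i ψ n) z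
  change P.extMk (cyclesToHom X Y P n (HomologicalComplex.cyclesMap ψ n z)) (n+1) rfl
    (d_iCycles X Y P n _) = _
  congr 1

/-- The derived-functor `Ext` agrees with `Abelian.Ext`. -/
noncomputable def extEquiv (X Y : ModuleCat.{u} R) (n : ℕ) :
    ((_root_.Ext R (ModuleCat.{u} R) n).obj (.op X)).obj Y ≃ₗ[R] Abelian.Ext X Y n :=
  extEquivOfResolution X Y (projectiveResolution X) n

lemma extEquiv_map {X X' : ModuleCat.{u} R} (f : X ⟶ X') (Y : ModuleCat.{u} R) (n : ℕ)
    (x : ((_root_.Ext R (ModuleCat.{u} R) n).obj (.op X')).obj Y) :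
    extEquiv X Y n (((_root_.Ext R (ModuleCat.{u} R) n).map f.op).app Y x) =
      (Ext.mk₀ f).comp (extEquiv X' Y n x) (zero_add n) :=
  extEquivOfResolution_map f _ _ Y n x

/-- The module `R ⧸ a ^ k`. -/
abbrev quotPow (a : Ideal R) (k : ℕ) : ModuleCat.{u} R := ModuleCat.of R (R ⧸ a ^ k)

/-- The projection `R ⧸ a ^ m ⟶ R ⧸ a ^ k` for `k ≤ m`. -/
def quotPowMap (a : Ideal R) {k m : ℕ} (h : k ≤ m) : quotPow a m ⟶ quotPow a k :=
  ModuleCat.ofHom (Submodule.mapQ _ _ LinearMap.id (Ideal.pow_le_pow_right h))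

/-- The map `Ext (R ⧸ a ^ k) N ⟶ Ext (R ⧸ a ^ m) N` for `k ≤ m`. -/
noncomputable def extTransition (a : Ideal R) (N : ModuleCat.{u} R) (i : ℕ) (k m : ℕ) (h : k ≤ m) :
    Abelian.Ext (quotPow a k) N i →ₗ[R] Abelian.Ext (quotPow a m) N i where
  toFun x := (Ext.mk₀ (quotPowMap a h)).comp x (zero_add i)
  map_add' := by simp
  map_smul' := by simp

instance (a : Ideal R) (N : ModuleCat.{u} R) (i : ℕ) :
    DirectedSystem (fun k => Abelian.Ext (quotPow a k) N i) (fun k m h => extTransition a N i k m h)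
      where
  map_self k x := by
    have : quotPowMap a (le_refl k) = 𝟙 _ := by
      ext; rfl
    simp [extTransition, this]
  map_map k m l h1 h2 x := by
    have : quotPowMap a (h1.trans h2) = quotPowMap a h2 ≫ quotPowMap a h1 := by
      ext; rfl
    simp [extTransition, this]

/-- Local cohomology as the direct limit of the modules `Ext (R ⧸ a ^ k) N`. -/
abbrev lc (a : Ideal R) (i : ℕ) (N : ModuleCat.{u} R) : Type u :=
  Module.DirectLimit (fun k => Abelian.Ext (quotPow a k) N i) (extTransition a N i)

/-- The structure map of the direct limit `lc a i N`. -/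
noncomputable abbrev lcι (a : Ideal R) (i : ℕ) (N : ModuleCat.{u} R) (k : ℕ) :
    Abelian.Ext (quotPow a k) N i →ₗ[R] lc a i N :=
  Module.DirectLimit.of R ℕ _ (extTransition a N i) k

/-- The diagram whose colimit computes local cohomology at `N`. -/
noncomputable def lcDiagram (a : Ideal R) (i : ℕ) (N : ModuleCat.{u} R) : ℕᵒᵖᵒᵖ ⥤ ModuleCat.{u} R :=
  localCohomology.diagram (localCohomology.idealPowersDiagram a) i ⋙ (evaluation _ _).obj N

lemma lcDiagram_map (a : Ideal R) (i : ℕ) (N : ModuleCat.{u} R) {k m : ℕᵒᵖᵒᵖ} (h : k ⟶ m) (x) :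
    extEquiv (quotPow a m.unop.unop) N i ((lcDiagram a i N).map h x) =
      extTransition a N i k.unop.unop m.unop.unop (leOfHom h.unop.unop)
        (extEquiv (quotPow a k.unop.unop) N i x) :=
  extEquiv_map _ _ _ _

/-- The cocone on `lcDiagram` with point `lc a i N`. -/
noncomputable def lcCocone (a : Ideal R) (i : ℕ) (N : ModuleCat.{u} R) :
    Cocone (lcDiagram a i N) where
  pt := ModuleCat.of R (lc a i N)
  ι := {
    app k := ModuleCat.ofHom (lcι a i N k.unop.unop ∘ₗ
      (extEquiv (quotPow a k.unop.unop) N i).toLinearMap)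
    naturality k m h := by
      ext x
      refine (congrArg (lcι a i N m.unop.unop) (lcDiagram_map a i N h x)).trans ?_
      exact Module.DirectLimit.of_f }

instance (a : Ideal R) (i : ℕ) :
    HasColimit (localCohomology.diagram (localCohomology.idealPowersDiagram a) i) :=
  localCohomology.hasColimitDiagram.{u, 0} _ i

/-- The comparison map from `lc` to the colimit of `lcDiagram`. -/
noncomputable def lcLift (a : Ideal R) (i : ℕ) (N : ModuleCat.{u} R) :
    lc a i N →ₗ[R] (colimit (lcDiagram a i N) : ModuleCat.{u} R) :=
  Module.DirectLimit.lift R ℕ _ _ (fun k => (colimit.ι (lcDiagram a i N) (op (op k))).hom ∘ₗ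
    (extEquiv (quotPow a k) N i).symm.toLinearMap) (by
    intro k m h x
    obtain ⟨y, rfl⟩ := (extEquiv (quotPow a k) N i).surjective x
    have h1 := lcDiagram_map a i N (homOfLE h).op.op y
    have h2 := ConcreteCategory.congr_hom (colimit.w (lcDiagram a i N) (homOfLE h).op.op) y
    refine (congrArg (fun z => (colimit.ι (lcDiagram a i N) (op (op m))).hom
      ((extEquiv (quotPow a m) N i).symm z)) h1.symm).trans ?_
    refine Eq.trans ?_ (h2.trans (congrArg (colimit.ι (lcDiagram a i N) (op (op k))).hom
      ((extEquiv (quotPow a k) N i).symm_apply_apply y)).symm)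
    refine congrArg (fun z => (colimit.ι (lcDiagram a i N) (op (op m))).hom z) ?_
    exact LinearEquiv.symm_apply_apply _ _)

lemma lcLift_lcι (a : Ideal R) (i : ℕ) (N : ModuleCat.{u} R) (k : ℕ)
    (y : (lcDiagram a i N).obj (op (op k))) :
    lcLift a i N (lcι a i N k (extEquiv (quotPow a k) N i y)) =
      (colimit.ι (lcDiagram a i N) (op (op k))).hom y :=
  (Module.DirectLimit.lift_of _ _ _).trans (congrArg (colimit.ι (lcDiagram a i N) (op (op k))).hom
    ((extEquiv (quotPow a k) N i).symm_apply_apply y))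

lemma lcCocone_desc_ι (a : Ideal R) (i : ℕ) (N : ModuleCat.{u} R) (k : ℕ)
    (y : (lcDiagram a i N).obj (op (op k))) :
    (colimit.desc _ (lcCocone a i N)).hom ((colimit.ι (lcDiagram a i N) (op (op k))).hom y) =
      lcι a i N k (extEquiv (quotPow a k) N i y) :=
  ConcreteCategory.congr_hom (colimit.ι_desc (lcCocone a i N) (op (op k))) y

/-- The colimit of `lcDiagram` is `lc`. -/
noncomputable def lcEquivAux (a : Ideal R) (i : ℕ) (N : ModuleCat.{u} R) :
    (colimit (lcDiagram a i N) : ModuleCat.{u} R) ≃ₗ[R] lc a i N :=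
  LinearEquiv.ofLinearMap (colimit.desc _ (lcCocone a i N)).hom (lcLift a i N)
    (by
      ext k x
      obtain ⟨y, rfl⟩ := (extEquiv (quotPow a k) N i).surjective x
      refine (congrArg (colimit.desc _ (lcCocone a i N)).hom (lcLift_lcι a i N k y)).trans ?_
      exact lcCocone_desc_ι a i N k y)
    (by
      have : colimit.desc _ (lcCocone a i N) ≫ ModuleCat.ofHom (lcLift a i N) = 𝟙 _ := by
        apply colimit.hom_ext
        intro k
        refine Eq.trans ?_ (Category.comp_id _).symm
        ext y
        refine (congrArg (lcLift a i N) (lcCocone_desc_ι a i N k.unop.unop y)).trans ?_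
        exact lcLift_lcι a i N k.unop.unop y
      exact congrArg ModuleCat.Hom.hom this)

/-- The local cohomology of Mathlib is isomorphic to `lc`. -/
noncomputable def lcEquiv (a : Ideal R) (i : ℕ) (N : ModuleCat.{u} R) :
    (localCohomology a i).obj N ≃ₗ[R] lc a i N :=
  (show (localCohomology a i).obj N ≅ colimit (lcDiagram a i N) from
    colimitObjIsoColimitCompEvaluation _ N).toLinearEquiv ≪≫ₗ lcEquivAux a i N

end ExtComparison

section PowTorsion

variable {R : Type u} [CommRing R]

/-- The `a`-power torsion submodule `Γ_a(N)`. -/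
def powTorsion (a : Ideal R) (N : Type u) [AddCommGroup N] [Module R N] : Submodule R N where
  carrier := {x | ∃ k : ℕ, ∀ r ∈ a ^ k, r • x = 0}
  add_mem' := by
    rintro x y ⟨k, hk⟩ ⟨l, hl⟩
    refine ⟨max k l, fun r hr => ?_⟩
    rw [smul_add, hk r (Ideal.pow_le_pow_right (le_max_left _ _) hr),
      hl r (Ideal.pow_le_pow_right (le_max_right _ _) hr), add_zero]
  zero_mem' := ⟨0, by simp⟩
  smul_mem' := by
    rintro c x ⟨k, hk⟩
    exact ⟨k, fun r hr => by rw [smul_comm, hk r hr, smul_zero]⟩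

variable {N : Type u} [AddCommGroup N] [Module R N]

lemma mem_powTorsion {a : Ideal R} {x : N} : x ∈ powTorsion a N ↔ ∃ k : ℕ, ∀ r ∈ a ^ k, r • x = 0 :=
    Iff.rfl

lemma exists_pow_smul_eq_zero_of_fg {a : Ideal R} {P : Submodule R N} (hP : P.FG)
    (h : P ≤ powTorsion a N) :
    ∃ k : ℕ, ∀ r ∈ a ^ k, ∀ x ∈ P, r • x = 0 := by
  obtain ⟨s, rfl⟩ := hP
  have : ∀ x : N, ∃ k : ℕ, x ∈ s → ∀ r ∈ a ^ k, r • x = 0 := by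
    intro x
    by_cases hx : x ∈ s
    · obtain ⟨k, hk⟩ := h (Submodule.subset_span hx)
      exact ⟨k, fun _ => hk⟩
    · exact ⟨0, fun h => (hx h).elim⟩
  choose k hk using this
  refine ⟨s.sup k, fun r hr x hx => ?_⟩
  induction hx using Submodule.span_induction with
  | mem x hx => exact hk x hx r (Ideal.pow_le_pow_right (Finset.le_sup hx) hr)
  | zero => simp
  | add x y _ _ h1 h2 => rw [smul_add, h1, h2, add_zero]
  | smul c x _ h1 => rw [smul_comm, h1, smul_zero]

lemma mem_powTorsion_of_smul_mem [IsNoetherianRing R] {a : Ideal R} {x : N} {k : ℕ}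
    (h : ∀ r ∈ a ^ k, r • x ∈ powTorsion a N) :
    x ∈ powTorsion a N := by
  obtain ⟨l, hl⟩ := exists_pow_smul_eq_zero_of_fg (a := a)
    (P := Submodule.map (LinearMap.toSpanSingleton R N x) (a ^ k))
    ((IsNoetherian.noetherian (a ^ k)).map _) (by rintro _ ⟨r, hr, rfl⟩; exact h r hr)
  refine ⟨l + k, fun r hr => ?_⟩
  rw [pow_add] at hr
  induction hr using Submodule.mul_induction_on' with
  | mem_mul_mem m hm n hn =>
    rw [mul_smul]
    exact hl m hm _ ⟨n, hn, rfl⟩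
  | add x _ y _ h1 h2 => rw [add_smul, h1, h2, add_zero]

lemma powTorsion_quotient_powTorsion [IsNoetherianRing R] (a : Ideal R) :
    powTorsion a (N ⧸ powTorsion a N) = ⊥ := by
  rw [eq_bot_iff]
  rintro x ⟨k, hk⟩
  obtain ⟨x, rfl⟩ := Submodule.Quotient.mk_surjective _ x
  simp only [← Submodule.Quotient.mk_smul, Submodule.Quotient.mk_eq_zero] at hk
  simpa using mem_powTorsion_of_smul_mem hk

lemma injective_powTorsion [IsNoetherianRing R] (a : Ideal R) [Module.Injective R N] :
    Module.Injective R (powTorsion a N) := by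
  apply Module.Baer.injective
  intro I f
  obtain ⟨k, hk⟩ := exists_pow_smul_eq_zero_of_fg (a := a)
    (P := LinearMap.range ((powTorsion a N).subtype ∘ₗ f)) (by
      rw [LinearMap.range_eq_map]
      have : Module.Finite R I := inferInstance
      exact this.fg_top.map _) (by rintro _ ⟨x, rfl⟩; exact (f x).2)
  obtain ⟨c, hc⟩ := Ideal.exists_pow_inf_eq_pow_smul a (M := R) I
  let m := k + c
  let K : Submodule R I := Submodule.comap I.subtype (a ^ m)
  have hKf : K ≤ LinearMap.ker f := by
    rintro ⟨x, hx⟩ hxK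
    have h1 : x ∈ (a ^ m • ⊤ ⊓ I : Submodule R R) := ⟨by simpa [K] using hxK, hx⟩
    rw [hc m (by simp [m])] at h1
    have h2 : x ∈ a ^ k • I := by
      simp only [m, Nat.add_sub_cancel] at h1
      exact Submodule.smul_mono le_rfl inf_le_right h1
    have h3 : ∀ x ∈ a ^ k • I, ∃ hx : x ∈ I, f ⟨x, hx⟩ = 0 := by
      intro x hx
      induction hx using Submodule.smul_induction_on' with
      | smul r hr n hn =>
        refine ⟨I.smul_mem r hn, ?_⟩
        have := hk r hr _ ⟨⟨n, hn⟩, rfl⟩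
        have e : (⟨r • n, I.smul_mem r hn⟩ : I) = r • ⟨n, hn⟩ := rfl
        rw [e, map_smul]
        exact Subtype.ext this
      | add x _ y _ h1 h2 =>
        obtain ⟨h1, h1'⟩ := h1
        obtain ⟨h2, h2'⟩ := h2
        refine ⟨I.add_mem h1 h2, ?_⟩
        have e : (⟨x + y, I.add_mem h1 h2⟩ : I) = ⟨x, h1⟩ + ⟨y, h2⟩ := rfl
        rw [e, map_add, h1', h2', add_zero]
    exact (h3 x h2).2
  obtain ⟨g, hg⟩ := Module.Injective.out (R := R) (Q := N)
    (Submodule.mapQ K (a ^ m) I.subtype le_rfl) (by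
    rw [← LinearMap.ker_eq_bot, Submodule.ker_mapQ]
    simp [K]) ((powTorsion a N).subtype ∘ₗ K.liftQ f hKf)
  have he : g (Submodule.Quotient.mk 1) ∈ powTorsion a N := ⟨m, fun r hr => by
    rw [← map_smul, ← Submodule.Quotient.mk_smul]
    have : (Submodule.Quotient.mk (r • 1) : R ⧸ a ^ m) = 0 := by
      rw [Submodule.Quotient.mk_eq_zero]; simpa using hr
    rw [this, map_zero]⟩
  refine ⟨LinearMap.toSpanSingleton R _ ⟨_, he⟩, fun x hx => ?_⟩
  apply Subtype.ext
  have := hg (Submodule.Quotient.mk ⟨x, hx⟩)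
  simp only [Submodule.mapQ_apply, Submodule.subtype_apply, LinearMap.comp_apply,
    Submodule.liftQ_apply] at this
  rw [← this]
  simp only [LinearMap.toSpanSingleton_apply, Submodule.coe_smul]
  rw [← map_smul, ← Submodule.Quotient.mk_smul, smul_eq_mul, mul_one]

lemma injective_quotient_powTorsion [IsNoetherianRing R] (a : Ideal R) [Module.Injective R N] :
    Module.Injective R (N ⧸ powTorsion a N) := by
  have := injective_powTorsion (N := N) a
  obtain ⟨r, hr⟩ := Module.Injective.out (R := R) (powTorsion a N).subtype Subtype.val_injective
    LinearMap.id
  let s : (N ⧸ powTorsion a N) →ₗ[R] N :=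
    Submodule.liftQ _ (LinearMap.id - (powTorsion a N).subtype ∘ₗ r) (by
    intro x hx
    have : r x = ⟨x, hx⟩ := hr ⟨x, hx⟩
    simp [this])
  have hs : ∀ x, Submodule.Quotient.mk (s x) = x := by
    intro x
    obtain ⟨x, rfl⟩ := Submodule.Quotient.mk_surjective _ x
    simp [s]
  constructor
  intro X Y _ _ _ _ f hf g
  obtain ⟨h, hh⟩ := Module.Injective.out (R := R) (Q := N) f hf (s ∘ₗ g)
  exact ⟨Submodule.mkQ _ ∘ₗ h, fun x => by simp [hh, hs]⟩

variable (R N) in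
lemma exists_injective_embedding :
    ∃ (I : Type u) (_ : AddCommGroup I) (_ : Module R I) (f : N →ₗ[R] I),
    Module.Injective R I ∧ Function.Injective f := by
  let I := Injective.under (ModuleCat.of R N)
  have : Injective (ModuleCat.of R I) := inferInstanceAs (Injective (Injective.under _))
  refine ⟨I, inferInstance, inferInstance, (Injective.ι (ModuleCat.of R N)).hom,
    Module.injective_module_of_injective_object R I, ?_⟩
  exact (ModuleCat.mono_iff_injective _).mp inferInstance

lemma exists_torsion_injective_embedding [IsNoetherianRing R] {a : Ideal R}
    (h : powTorsion a N = ⊤) :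
    ∃ (I : Type u) (_ : AddCommGroup I) (_ : Module R I) (f : N →ₗ[R] I),
    Module.Injective R I ∧ powTorsion a I = ⊤ ∧ Function.Injective f := by
  obtain ⟨I, _, _, f, hI, hf⟩ := exists_injective_embedding R N
  refine ⟨powTorsion a I, inferInstance, inferInstance, f.codRestrict _ ?_, injective_powTorsion a,
    ?_, ?_⟩
  · intro x
    obtain ⟨k, hk⟩ : x ∈ powTorsion a N := h ▸ Submodule.mem_top
    exact ⟨k, fun r hr => by rw [← map_smul, hk r hr, map_zero]⟩
  · rw [eq_top_iff]
    rintro ⟨x, k, hk⟩ -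
    exact ⟨k, fun r hr => Subtype.ext (hk r hr)⟩
  · intro x y hxy
    exact hf (congrArg Subtype.val hxy)

variable (N) in
lemma exists_torsionFree_injective [IsNoetherianRing R] (a : Ideal R) :
    ∃ (I : Type u) (_ : AddCommGroup I) (_ : Module R I) (f : N →ₗ[R] I),
    Module.Injective R I ∧ powTorsion a I = ⊥ ∧ LinearMap.ker f = powTorsion a N := by
  obtain ⟨I, _, _, f, hI, hf⟩ := exists_injective_embedding R N
  refine ⟨I ⧸ powTorsion a I, inferInstance, inferInstance, Submodule.mkQ _ ∘ₗ f,
    injective_quotient_powTorsion a,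
    powTorsion_quotient_powTorsion a, ?_⟩
  ext x
  simp only [LinearMap.mem_ker, LinearMap.comp_apply, Submodule.mkQ_apply,
    Submodule.Quotient.mk_eq_zero,
    mem_powTorsion, ← map_smul, map_eq_zero_iff f hf]

end PowTorsion

section DimensionShift

open Abelian

variable {R : Type u} [CommRing R]

variable {X Y Z : Type u} [AddCommGroup X] [Module R X] [AddCommGroup Y] [Module R Y]
  [AddCommGroup Z] [Module R Z]

/-- The short complex of modules given by an exact pair of linear maps. -/
abbrev exactComplex (f : X →ₗ[R] Y) (g : Y →ₗ[R] Z) (h : Function.Exact f g) :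
    ShortComplex (ModuleCat.{u} R) :=
  ShortComplex.moduleCatMk f g h.linearMap_comp_eq_zero

lemma exactComplex_shortExact (f : X →ₗ[R] Y) (g : Y →ₗ[R] Z) (h : Function.Exact f g)
    (hf : Function.Injective f) (hg : Function.Surjective g) :
    (exactComplex f g h).ShortExact :=
  ModuleCat.shortComplex_shortExact _ h hf hg

lemma quotPow_hom_ext {a : Ideal R} {k : ℕ} {N : ModuleCat.{u} R} {f g : quotPow a k ⟶ N}
    (h : f.hom (Submodule.Quotient.mk 1) = g.hom (Submodule.Quotient.mk 1)) : f = g := by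
  ext
  exact h

lemma smul_quotPow_hom {a : Ideal R} {k : ℕ} {N : ModuleCat.{u} R} (f : quotPow a k ⟶ N) {r : R}
    (hr : r ∈ a ^ k) (x) : r • f.hom x = 0 := by
  obtain ⟨x, rfl⟩ := Submodule.Quotient.mk_surjective _ x
  rw [← map_smul, ← Submodule.Quotient.mk_smul]
  have : (Submodule.Quotient.mk (r • x) : R ⧸ a ^ k) = 0 := by
    rw [Submodule.Quotient.mk_eq_zero]; exact Ideal.mul_mem_right _ _ hr
  rw [this, map_zero]

/-- The map `R ⧸ a ^ k ⟶ N` sending `1` to an element killed by `a ^ k`. -/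
def quotPowDesc (a : Ideal R) (k : ℕ) {N : ModuleCat.{u} R} (x : N) (h : ∀ r ∈ a ^ k, r • x = 0) :
    quotPow a k ⟶ N :=
  ModuleCat.ofHom (Submodule.liftQ _ (LinearMap.toSpanSingleton R N x) (fun r hr => h r hr))

lemma quotPowDesc_one (a : Ideal R) (k : ℕ) {N : ModuleCat.{u} R} (x : N)
    (h : ∀ r ∈ a ^ k, r • x = 0) : (quotPowDesc a k x h).hom (Submodule.Quotient.mk 1) = x := by
  exact (Submodule.liftQ_apply _ _ _).trans (one_smul R x)

lemma extTransition_comp (a : Ideal R) {N N' : ModuleCat.{u} R} {i j l : ℕ} {k m : ℕ} (h : k ≤ m)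
    (x : Abelian.Ext (quotPow a k) N i) (y : Abelian.Ext N N' j) (hl : i + j = l) :
    extTransition a N' l k m h (x.comp y hl) = (extTransition a N i k m h x).comp y hl := by
  simp only [extTransition, LinearMap.coe_mk, AddHom.coe_mk]
  rw [Ext.comp_assoc (a₁₂ := i)]
  all_goals omega

lemma smul_quotPow_ext {a : Ideal R} {N : ModuleCat.{u} R} {i : ℕ} {k : ℕ} {r : R} (hr : r ∈ a ^ k)
    (x : Abelian.Ext (quotPow a k) N i) : r • x = 0 := by
  have : r • 𝟙 (quotPow a k) = 0 := by
    ext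
    exact smul_quotPow_hom (𝟙 (quotPow a k)) hr (Submodule.Quotient.mk 1)
  calc r • x = r • (Ext.mk₀ (𝟙 _)).comp x (zero_add i) := by simp
    _ = 0 := by rw [← Ext.smul_comp, ← Ext.mk₀_smul, this]; simp

lemma powTorsion_lc (a : Ideal R) (i : ℕ) (N : ModuleCat.{u} R) : powTorsion a (lc a i N) = ⊤ := by
  rw [eq_top_iff]
  rintro x -
  obtain ⟨k, x, rfl⟩ := Module.DirectLimit.exists_of x
  refine ⟨k, fun r hr => ?_⟩
  rw [← map_smul, smul_quotPow_ext hr, map_zero]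

/-- Every class in `Ext (R ⧸ a ^ k) N` dies in the direct limit. -/
def ExtVanish (a : Ideal R) (i : ℕ) (N : ModuleCat.{u} R) : Prop :=
  ∀ (k : ℕ) (x : Abelian.Ext (quotPow a k) N i),
    ∃ (m : ℕ) (h : k ≤ m), extTransition a N i k m h x = 0

lemma extVanish_one {a : Ideal R} {S : ShortComplex (ModuleCat.{u} R)} (hS : S.ShortExact)
    [Injective S.X₂] (h : powTorsion a S.X₂ = ⊤) : ExtVanish a 1 S.X₁ := by
  intro k x
  obtain ⟨y, rfl⟩ := Ext.covariant_sequence_exact₁ _ hS x (Ext.eq_zero_of_injective _) (zero_add 1)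
  obtain ⟨φ, rfl⟩ := Ext.homEquiv₀.symm.surjective y
  obtain ⟨e, he⟩ := hS.moduleCat_surjective_g (φ.hom (Submodule.Quotient.mk 1))
  obtain ⟨m, hm⟩ : e ∈ powTorsion a S.X₂ := h ▸ Submodule.mem_top
  refine ⟨max k m, le_max_left _ _, ?_⟩
  rw [extTransition_comp]
  have : quotPowMap a (le_max_left k m) ≫ φ =
    quotPowDesc a (max k m) e
      (fun r hr => hm r (Ideal.pow_le_pow_right (le_max_right _ _) hr)) ≫ S.g := by
    apply quotPow_hom_ext
    refine Eq.trans ?_ (congrArg S.g.hom (quotPowDesc_one _ _ _ _).symm)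
    exact he.symm
  simp only [extTransition, LinearMap.coe_mk, AddHom.coe_mk, Ext.homEquiv₀_symm_apply,
    Ext.mk₀_comp_mk₀, this]
  rw [← Ext.mk₀_comp_mk₀, Ext.comp_assoc (a₁₂ := 0) (a₂₃ := 1) (a := 1)]
  · rw [hS.comp_extClass, Ext.comp_zero]
  all_goals omega

lemma extVanish_succ {a : Ideal R} {S : ShortComplex (ModuleCat.{u} R)} (hS : S.ShortExact)
    [Injective S.X₂] {i : ℕ} (h : ExtVanish a i S.X₃) : ExtVanish a (i + 1) S.X₁ := by
  intro k x
  obtain ⟨y, rfl⟩ := Ext.covariant_sequence_exact₁ _ hS x (Ext.eq_zero_of_injective _) rfl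
  obtain ⟨m, hm, h0⟩ := h k y
  refine ⟨m, hm, ?_⟩
  rw [extTransition_comp, h0, Ext.zero_comp]

lemma powTorsion_of_surjective {a : Ideal R} {f : X →ₗ[R] Y} (hf : Function.Surjective f)
    (h : powTorsion a X = ⊤) : powTorsion a Y = ⊤ := by
  rw [eq_top_iff]
  rintro x -
  obtain ⟨x, rfl⟩ := hf x
  obtain ⟨m, hm⟩ : x ∈ powTorsion a X := h ▸ Submodule.mem_top
  exact ⟨m, fun r hr => by rw [← map_smul, hm r hr, map_zero]⟩

theorem extVanish_of_torsion [IsNoetherianRing R] {a : Ideal R} (i : ℕ) :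
    ∀ (N : Type u) [AddCommGroup N] [Module R N] (_ : powTorsion a N = ⊤),
      ExtVanish a (i + 1) (ModuleCat.of R N) := by
  induction i with
  | zero =>
    intro N _ _ hN
    obtain ⟨J, _, _, f, hJ, hJt, hf⟩ := exists_torsion_injective_embedding hN
    have hS := exactComplex_shortExact f (LinearMap.range f).mkQ (LinearMap.exact_map_mkQ_range f)
      hf
      (Submodule.mkQ_surjective _)
    have : Injective (ModuleCat.of R J) := Module.injective_object_of_injective_module R J
    exact @extVanish_one _ _ _ _ hS this hJt
  | succ i ih =>
    intro N _ _ hN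
    obtain ⟨J, _, _, f, hJ, hJt, hf⟩ := exists_torsion_injective_embedding hN
    have hS := exactComplex_shortExact f (LinearMap.range f).mkQ (LinearMap.exact_map_mkQ_range f)
      hf
      (Submodule.mkQ_surjective _)
    have : Injective (ModuleCat.of R J) := Module.injective_object_of_injective_module R J
    exact @extVanish_succ _ _ _ _ hS this _
      (ih _ (powTorsion_of_surjective (Submodule.mkQ_surjective _) hJt))

lemma nonempty_lc_equiv {a : Ideal R} {N N' : ModuleCat.{u} R} {i j : ℕ}
    (φ : ∀ k, Abelian.Ext (quotPow a k) N i →ₗ[R] Abelian.Ext (quotPow a k) N' j)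
    (hφ : ∀ k m h x, φ m (extTransition a N i k m h x) = extTransition a N' j k m h (φ k x))
    (hinj : ∀ k x, φ k x = 0 → ∃ (m : ℕ) (h : k ≤ m), extTransition a N i k m h x = 0)
    (hsurj : ∀ k y, ∃ (m : ℕ) (h : k ≤ m) (x : _), φ m x = extTransition a N' j k m h y) :
    Nonempty (lc a i N ≃ₗ[R] lc a j N') := by
  let Φ : lc a i N →ₗ[R] lc a j N' := Module.DirectLimit.map φ (by
    intro k m h; ext x; exact hφ k m h x)
  refine ⟨LinearEquiv.ofBijective Φ ⟨?_, ?_⟩⟩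
  · rw [injective_iff_map_eq_zero]
    intro x hx
    obtain ⟨k, x, rfl⟩ := Module.DirectLimit.exists_of x
    rw [Module.DirectLimit.map_apply_of] at hx
    obtain ⟨m, h, h0⟩ := Module.DirectLimit.of.zero_exact hx
    rw [← hφ] at h0
    obtain ⟨m', h', h0'⟩ := hinj _ _ h0
    rw [← Module.DirectLimit.of_f (hij := h), ← Module.DirectLimit.of_f (hij := h'), h0', map_zero]
  · intro y
    obtain ⟨k, y, rfl⟩ := Module.DirectLimit.exists_of y
    obtain ⟨m, h, x, hx⟩ := hsurj k y
    exact ⟨lcι a i N m x, by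
      rw [Module.DirectLimit.map_apply_of, hx, Module.DirectLimit.of_f]⟩

/-- Composition of extension classes with a fixed class on the right. -/
noncomputable def extPostcomp (A : ModuleCat.{u} R) {N N' : ModuleCat.{u} R} {j : ℕ}
    (y : Abelian.Ext N N' j) {i l : ℕ} (h : i + j = l) :
    Abelian.Ext A N i →ₗ[R] Abelian.Ext A N' l where
  toFun x := x.comp y h
  map_add' := by simp
  map_smul' := by simp

theorem nonempty_lc_equiv_quotient_torsion [IsNoetherianRing R] {a : Ideal R}
    {S : ShortComplex (ModuleCat.{u} R)} (hS : S.ShortExact) (hX : powTorsion a S.X₁ = ⊤) (i : ℕ) :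
    Nonempty (lc a (i + 1) S.X₂ ≃ₗ[R] lc a (i + 1) S.X₃) := by
  refine nonempty_lc_equiv (fun k => extPostcomp _ (Ext.mk₀ S.g) (add_zero (i + 1)))
    (fun k m h x => (extTransition_comp a h x (Ext.mk₀ S.g) (add_zero (i + 1))).symm) ?_ ?_
  · intro k x hx
    obtain ⟨y, rfl⟩ := Ext.covariant_sequence_exact₂ _ hS x hx
    obtain ⟨m, hm, h0⟩ := extVanish_of_torsion i _ hX k y
    refine ⟨m, hm, ?_⟩
    rw [extTransition_comp]
    exact (congrArg (fun z => Ext.comp z (Ext.mk₀ S.f) rfl) h0).trans (Ext.zero_comp _ _ _ _ _)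
  · intro k y
    obtain ⟨m, hm, h0⟩ := extVanish_of_torsion (i + 1) _ hX k (y.comp hS.extClass rfl)
    refine ⟨m, hm, ?_⟩
    refine Ext.covariant_sequence_exact₃ _ hS _ rfl ?_
    rw [← extTransition_comp]
    exact h0

lemma ext_quotPow_eq_zero {a : Ideal R} {E : ModuleCat.{u} R} [Injective E] (h : powTorsion a E = ⊥)
    {k i : ℕ} (x : Abelian.Ext (quotPow a k) E i) : x = 0 := by
  cases i with
  | zero =>
    obtain ⟨φ, rfl⟩ := Ext.homEquiv₀.symm.surjective x
    have : φ = 0 := by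
      apply quotPow_hom_ext
      have : φ.hom (Submodule.Quotient.mk 1) ∈ powTorsion a E :=
        ⟨k, fun r hr => smul_quotPow_hom φ hr _⟩
      rw [h] at this
      exact this
    simp [this]
  | succ i => exact Ext.eq_zero_of_injective _

theorem nonempty_lc_shift {a : Ideal R}
    {S : ShortComplex (ModuleCat.{u} R)} (hS : S.ShortExact) [Injective S.X₂]
    (h : powTorsion a S.X₂ = ⊥) (i : ℕ) :
    Nonempty (lc a i S.X₃ ≃ₗ[R] lc a (i + 1) S.X₁) := by
  refine nonempty_lc_equiv (fun k => extPostcomp _ hS.extClass (Eq.refl (i + 1)))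
    (fun k m h x => (extTransition_comp a h x hS.extClass (Eq.refl (i + 1))).symm) ?_ ?_
  · intro k x hx
    obtain ⟨y, rfl⟩ := Ext.covariant_sequence_exact₃ _ hS x rfl hx
    exact ⟨k, le_rfl, by rw [ext_quotPow_eq_zero h y, Ext.zero_comp, map_zero]⟩
  · intro k y
    exact ⟨k, le_rfl, Ext.covariant_sequence_exact₁ _ hS _ (ext_quotPow_eq_zero h _) rfl⟩

theorem nonempty_lc_zero (a : Ideal R) :
    Nonempty (lc a 0 (ModuleCat.of R X) ≃ₗ[R] powTorsion a X) := by
  let Φ : lc a 0 (ModuleCat.of R X) →ₗ[R] X := Module.DirectLimit.lift R ℕ _ _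
    (fun k =>
      { toFun x := (Ext.linearEquiv₀ (R := R) x).hom (Submodule.Quotient.mk 1)
        map_add' := by intros; rw [map_add]; rfl
        map_smul' := by intros; rw [map_smul]; rfl }) (by
    intro k m h x
    obtain ⟨φ, rfl⟩ := (Ext.linearEquiv₀ (R := R)).symm.surjective x
    have : extTransition a (ModuleCat.of R X) 0 k m h ((Ext.linearEquiv₀ (R := R)).symm φ) =
      (Ext.linearEquiv₀ (R := R)).symm (quotPowMap a h ≫ φ) := by
      exact Ext.mk₀_comp_mk₀ _ _
    simp only [this, LinearMap.coe_mk, AddHom.coe_mk, LinearEquiv.apply_symm_apply]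
    rfl)
  have hinj : Function.Injective Φ := by
    apply Module.DirectLimit.lift_injective
    intro k x y hxy
    apply (Ext.linearEquiv₀ (R := R)).injective
    exact quotPow_hom_ext hxy
  have hr : LinearMap.range Φ = powTorsion a X := by
    ext y
    constructor
    · rintro ⟨x, rfl⟩
      obtain ⟨k, x, rfl⟩ := Module.DirectLimit.exists_of x
      refine ⟨k, fun r hr => ?_⟩
      rw [Module.DirectLimit.lift_of]
      exact smul_quotPow_hom (Ext.linearEquiv₀ (R := R) x) hr _
    · rintro ⟨k, hk⟩
      refine ⟨lcι a 0 _ k ((Ext.linearEquiv₀ (R := R)).symm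
        (quotPowDesc a k (N := ModuleCat.of R X) y hk)), ?_⟩
      rw [Module.DirectLimit.lift_of]
      simp only [LinearMap.coe_mk, AddHom.coe_mk, LinearEquiv.apply_symm_apply]
      exact quotPowDesc_one _ _ _ _
  exact ⟨(LinearEquiv.ofInjective Φ hinj).trans (LinearEquiv.ofEq _ _ hr)⟩

theorem nonempty_lc_dimensionShift [IsNoetherianRing R] {a : Ideal R} (f : X →ₗ[R] Y)
    (g : Y →ₗ[R] Z) (hf : LinearMap.ker f = powTorsion a X) (h : Function.Exact f g)
    (hg : Function.Surjective g) (hY : Module.Injective R Y) (hY0 : powTorsion a Y = ⊥) (i : ℕ) :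
    Nonempty (lc a (i + 1) (ModuleCat.of R X) ≃ₗ[R] lc a i (ModuleCat.of R Z)) := by
  have hS := exactComplex_shortExact (powTorsion a X).subtype (powTorsion a X).mkQ
    (LinearMap.exact_subtype_mkQ _) Subtype.val_injective (Submodule.mkQ_surjective _)
  have hT := exactComplex_shortExact ((powTorsion a X).liftQ f hf.ge) g
    (by
      rw [LinearMap.exact_iff] at h ⊢
      rw [h, Submodule.range_liftQ])
    (by
      rw [← LinearMap.ker_eq_bot, Submodule.ker_liftQ_eq_bot _ _ _ hf.le]) hg
  have : Injective (ModuleCat.of R Y) := Module.injective_object_of_injective_module R Y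
  obtain ⟨e₁⟩ := nonempty_lc_equiv_quotient_torsion (a := a) hS (by
    rw [eq_top_iff]
    rintro ⟨x, k, hk⟩ -
    exact ⟨k, fun r hr => Subtype.ext (hk r hr)⟩) i
  obtain ⟨e₂⟩ := @nonempty_lc_shift _ _ _ _ hT this hY0 i
  exact ⟨e₁.trans e₂.symm⟩

end DimensionShift

section LocalFiniteness

open Abelian

variable {R : Type u} [CommRing R]

/-- `X` has a finitely generated submodule that agrees with `X` at every prime in `Φ`. -/
def FGS (Φ : Set (PrimeSpectrum R)) (X : Type u) [AddCommGroup X] [Module R X] : Prop :=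
  ∃ N : Submodule R X, N.FG ∧ ∀ x : X, ∀ p ∈ Φ, ∃ s ∉ p.asIdeal, s • x ∈ N

variable {X Y Z : Type u} [AddCommGroup X] [Module R X] [AddCommGroup Y] [Module R Y]
  [AddCommGroup Z] [Module R Z] {Φ : Set (PrimeSpectrum R)}

lemma FGS.of_finite [Module.Finite R X] : FGS Φ X :=
  ⟨⊤, Module.Finite.fg_top, fun _ p _ => ⟨1, p.2.one_notMem, trivial⟩⟩

lemma FGS.of_exact [IsNoetherianRing R] {f : X →ₗ[R] Y} {g : Y →ₗ[R] Z} (h : Function.Exact f g)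
    (hX : FGS Φ X) (hZ : FGS Φ Z) : FGS Φ Y := by
  obtain ⟨A, hA, hA'⟩ := hX
  obtain ⟨C, hC, hC'⟩ := hZ
  have : IsNoetherian R C := isNoetherian_of_fg_of_noetherian C hC
  have hfg : (LinearMap.range g ⊓ C).FG := by
    have := (isNoetherian_submodule.mp this) _ (inf_le_right : LinearMap.range g ⊓ C ≤ C)
    exact this
  obtain ⟨P, hP, hPg⟩ : ∃ P : Submodule R Y, P.FG ∧ P.map g = LinearMap.range g ⊓ C := by
    classical
    obtain ⟨s, hs⟩ := hfg
    have hsg : (s : Set Z) ⊆ g '' Set.univ := fun z hz => by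
      rw [Set.image_univ]
      exact (hs.le (Submodule.subset_span hz)).1
    obtain ⟨t, -, rfl⟩ := Finset.subset_set_image_iff.mp hsg
    exact ⟨_, ⟨t, rfl⟩, by rw [← hs, Submodule.map_span, Finset.coe_image]⟩
  refine ⟨P ⊔ A.map f, hP.sup (hA.map f), fun y p hp => ?_⟩
  obtain ⟨s, hs, hs'⟩ := hC' (g y) p hp
  have : s • g y ∈ P.map g := hPg ▸ ⟨⟨s • y, map_smul _ _ _⟩, hs'⟩
  obtain ⟨q, hq, hq'⟩ := this
  obtain ⟨x, hx⟩ := (h (s • y - q)).mp (by rw [map_sub, map_smul, hq', sub_self])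
  obtain ⟨t, ht, ht'⟩ := hA' x p hp
  refine ⟨t * s, fun hh => (p.2.mem_or_mem hh).elim ht hs, ?_⟩
  have : (t * s) • y = t • q + f (t • x) := by
    rw [map_smul, hx, smul_sub, mul_smul]; abel
  rw [this]
  exact Submodule.add_mem_sup (P.smul_mem _ hq) ⟨_, ht', rfl⟩

lemma FGS.of_injective [IsNoetherianRing R] {f : X →ₗ[R] Y} (hf : Function.Injective f)
    (h : FGS Φ Y) : FGS Φ X :=
  FGS.of_exact (f := (0 : PUnit.{u + 1} →ₗ[R] X)) (g := f)
    (by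
      intro y
      rw [map_eq_zero_iff f hf]
      simp [eq_comm]) FGS.of_finite h

lemma FGS.of_surjective {f : X →ₗ[R] Y} (hf : Function.Surjective f)
    (h : FGS Φ X) : FGS Φ Y := by
  obtain ⟨A, hA, hA'⟩ := h
  refine ⟨A.map f, hA.map f, fun y p hp => ?_⟩
  obtain ⟨x, rfl⟩ := hf y
  obtain ⟨s, hs, hs'⟩ := hA' x p hp
  exact ⟨s, hs, _, hs', map_smul _ _ _⟩

lemma FGS.pi [IsNoetherianRing R] (h : FGS Φ X) (n : ℕ) : FGS Φ (Fin n → X) := by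
  induction n with
  | zero => exact FGS.of_finite
  | succ n ih =>
    refine FGS.of_exact (f := LinearMap.single R (fun _ : Fin (n + 1) => X) 0)
      (g := LinearMap.funLeft R X Fin.succ) ?_ h ih
    intro y
    constructor
    · intro hy
      refine ⟨y 0, ?_⟩
      funext i
      refine Fin.cases ?_ (fun i => ?_) i
      · simp
      · have := congrFun hy i
        simp only [LinearMap.funLeft_apply] at this
        simp [this]
    · rintro ⟨x, rfl⟩
      ext i
      simp [LinearMap.funLeft_apply]

lemma FGS.ext [IsNoetherianRing R] {N : ModuleCat.{u} R} (h : FGS Φ N) (i : ℕ)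
    (A : ModuleCat.{u} R) [Module.Finite R A] : FGS Φ (Abelian.Ext A N i) := by
  induction i generalizing A with
  | zero =>
    obtain ⟨n, f, hf⟩ := Module.Finite.exists_fin' R A
    let g : Abelian.Ext A N 0 →ₗ[R] (Fin n → N) :=
      { toFun x i := (Ext.linearEquiv₀ (R := R) x).hom (f (Pi.single i 1))
        map_add' := by intros; rw [map_add]; rfl
        map_smul' := by intros; rw [map_smul]; rfl }
    refine FGS.of_injective (f := g) ?_ (h.pi n)
    intro x y hxy
    apply (Ext.linearEquiv₀ (R := R)).injective
    have : (Ext.linearEquiv₀ (R := R) x).hom ∘ₗ f = (Ext.linearEquiv₀ (R := R) y).hom ∘ₗ f := by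
      apply LinearMap.pi_ext'
      intro i
      ext
      exact congrFun hxy i
    ext z
    obtain ⟨z, rfl⟩ := hf z
    exact LinearMap.congr_fun this z
  | succ n ih =>
    obtain ⟨F, _, _, _, _, f, surjf⟩ := Module.exists_finite_presentation R A
    let exac := LinearMap.shortExact_shortComplexKer surjf
    exact FGS.of_surjective (f := exac.extClass.precompOfLinear R N (add_comm 1 n))
      (precomp_extClass_surjective_of_projective_X₂ N exac n) (ih _)

lemma FGS.torsionBySet_of_injective [IsNoetherianRing R] {a : Ideal R} {f : X →ₗ[R] Y}
    (hf : Function.Injective f) (h : FGS Φ (Submodule.torsionBySet R Y (a : Set R))) :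
    FGS Φ (Submodule.torsionBySet R X (a : Set R)) :=
  FGS.of_injective (f := f.restrict (p := Submodule.torsionBySet R X (a : Set R))
    (q := Submodule.torsionBySet R Y (a : Set R)) (fun x hx => by
      rw [Submodule.mem_torsionBySet_iff] at hx ⊢
      intro r
      rw [← map_smul, hx r, map_zero]))
    (fun x y hxy => Subtype.ext (hf (congrArg Subtype.val hxy))) h

lemma FGS.torsionBySet_of_hom {a : Ideal R}
    (h : FGS Φ (Abelian.Ext (quotPow a 1) (ModuleCat.of R X) 0)) :
    FGS Φ (Submodule.torsionBySet R X (a : Set R)) := by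
  let g : Abelian.Ext (quotPow a 1) (ModuleCat.of R X) 0 →ₗ[R] X :=
    { toFun x := (Ext.linearEquiv₀ (R := R) x).hom (Submodule.Quotient.mk 1)
      map_add' := by intros; rw [map_add]; rfl
      map_smul' := by intros; rw [map_smul]; rfl }
  refine FGS.of_surjective (f := g.codRestrict (Submodule.torsionBySet R X (a : Set R)) ?_) ?_ h
  · intro x
    rw [Submodule.mem_torsionBySet_iff]
    intro r
    exact smul_quotPow_hom (Ext.linearEquiv₀ (R := R) x) (by simp) _
  · rintro ⟨x, hx⟩
    rw [Submodule.mem_torsionBySet_iff] at hx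
    refine ⟨(Ext.linearEquiv₀ (R := R)).symm (quotPowDesc a 1 (N := ModuleCat.of R X) x
      fun r hr => hx ⟨r, by simpa using hr⟩), ?_⟩
    apply Subtype.ext
    simp only [LinearMap.codRestrict_apply, g, LinearMap.coe_mk, AddHom.coe_mk,
      LinearEquiv.apply_symm_apply]
    exact quotPowDesc_one _ _ _ _

lemma FGS.ext_X₃ [IsNoetherianRing R] {S : ShortComplex (ModuleCat.{u} R)} (hS : S.ShortExact)
    (A : ModuleCat.{u} R) (j : ℕ) (h₂ : FGS Φ (Abelian.Ext A S.X₂ j))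
    (h₁ : FGS Φ (Abelian.Ext A S.X₁ (j + 1))) : FGS Φ (Abelian.Ext A S.X₃ j) := by
  refine FGS.of_exact (f := extPostcomp A (Ext.mk₀ S.g) (add_zero j))
    (g := extPostcomp A hS.extClass (Eq.refl (j + 1))) ?_ h₂ h₁
  intro x
  constructor
  · intro hx
    exact Ext.covariant_sequence_exact₃ _ hS x rfl hx
  · rintro ⟨y, rfl⟩
    simp only [extPostcomp, LinearMap.coe_mk, AddHom.coe_mk]
    rw [Ext.comp_assoc (a₁₂ := j) (a₂₃ := 1)]
    · rw [hS.comp_extClass, Ext.comp_zero]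
    all_goals omega

theorem fgs_torsionBySet_lc [IsNoetherianRing R] {a : Ideal R} (i : ℕ) :
    ∀ (N : Type u) [AddCommGroup N] [Module R N]
    (_ : ∀ j ≤ i, FGS Φ (Abelian.Ext (quotPow a 1) (ModuleCat.of R N) j))
    (_ : ∀ j < i, FGS Φ (lc a j (ModuleCat.of R N))),
    FGS Φ (Submodule.torsionBySet R (lc a i (ModuleCat.of R N)) (a : Set R)) := by
  induction i with
  | zero =>
    intro N _ _ h1 _
    obtain ⟨e⟩ := nonempty_lc_zero (X := N) a
    exact FGS.torsionBySet_of_injective (f := (powTorsion a N).subtype ∘ₗ e.toLinearMap)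
      (Subtype.val_injective.comp e.injective) (FGS.torsionBySet_of_hom (h1 0 le_rfl))
  | succ i ih =>
    intro N _ _ h1 h2
    obtain ⟨E, _, _, f, hE, hE0, hf⟩ := exists_torsionFree_injective N a
    obtain ⟨e₀⟩ := nonempty_lc_zero (X := N) a
    have hΓ : FGS Φ (powTorsion a N) :=
      (h2 0 i.succ_pos).of_surjective (f := e₀.toLinearMap) e₀.surjective
    have hex := LinearMap.exact_map_mkQ_range f
    have e := nonempty_lc_dimensionShift f (LinearMap.range f).mkQ hf hex
      (Submodule.mkQ_surjective _) hE hE0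
    have hS := exactComplex_shortExact (powTorsion a N).subtype (powTorsion a N).mkQ
      (LinearMap.exact_subtype_mkQ _) Subtype.val_injective (Submodule.mkQ_surjective _)
    have hT := exactComplex_shortExact ((powTorsion a N).liftQ f hf.ge) (LinearMap.range f).mkQ
      (by
        rw [LinearMap.exact_iff] at hex ⊢
        rw [hex, Submodule.range_liftQ])
      (by
        rw [← LinearMap.ker_eq_bot, Submodule.ker_liftQ_eq_bot _ _ _ hf.le])
      (Submodule.mkQ_surjective _)
    have hEinj : Injective (ModuleCat.of R E) := Module.injective_object_of_injective_module R E
    obtain ⟨e'⟩ := e i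
    refine FGS.torsionBySet_of_injective (f := e'.toLinearMap) e'.injective (ih _ ?_ ?_)
    · intro j hj
      refine FGS.ext_X₃ hT _ j ?_ (FGS.ext_X₃ hS _ (j + 1) (h1 (j + 1) (by omega)) ?_)
      · have : Subsingleton (Abelian.Ext (quotPow a 1) (ModuleCat.of R E) j) :=
          subsingleton_of_forall_eq 0 (fun x => ext_quotPow_eq_zero hE0 x)
        have h0 : FGS Φ (Abelian.Ext (quotPow a 1) (ModuleCat.of R E) j) := FGS.of_finite
        exact h0
      · exact FGS.ext hΓ _ _
    · intro j hj
      obtain ⟨e''⟩ := e j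
      exact (h2 (j + 1) (by omega)).of_surjective (f := e''.toLinearMap) e''.surjective

end LocalFiniteness

section Localization

open Abelian

variable {R : Type u} [CommRing R]

variable {X Y Z : Type u} [AddCommGroup X] [Module R X] [AddCommGroup Y] [Module R Y]
  [AddCommGroup Z] [Module R Z]

lemma exists_smul_eq_zero_of_fg {S : Submonoid R} {P : Submodule R X} (hP : P.FG)
    (h : ∀ x ∈ P, ∃ s ∈ S, s • x = 0) : ∃ s ∈ S, ∀ x ∈ P, s • x = 0 := by
  obtain ⟨t, rfl⟩ := hP
  have : ∀ x : X, ∃ s ∈ S, x ∈ t → s • x = 0 := by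
    intro x
    by_cases hx : x ∈ t
    · obtain ⟨s, hs, h⟩ := h x (Submodule.subset_span hx)
      exact ⟨s, hs, fun _ => h⟩
    · exact ⟨1, S.one_mem, fun h => (hx h).elim⟩
  choose s hs h0 using this
  refine ⟨∏ x ∈ t, s x, S.prod_mem fun x _ => hs x, fun x hx => ?_⟩
  induction hx using Submodule.span_induction with
  | mem x hx =>
    obtain ⟨c, hc⟩ := Finset.dvd_prod_of_mem s hx
    rw [hc, mul_comm, mul_smul, h0 x hx, smul_zero]
  | zero => simp
  | add x y _ _ h1 h2 => rw [smul_add, h1, h2, add_zero]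
  | smul c x _ h1 => rw [smul_comm, h1, smul_zero]

variable (S : Submonoid R)

lemma forall_mem_map_pow_smul_eq_zero {A : Type u} [CommRing A] [Algebra R A] {V : Type u}
    [AddCommGroup V] [Module A V] {a : Ideal R} {k : ℕ} {y : V} :
    (∀ r ∈ (a.map (algebraMap R A)) ^ k, r • y = 0) ↔ ∀ r ∈ a ^ k, algebraMap R A r • y = 0 := by
  rw [← Ideal.map_pow]
  constructor
  · exact fun h r hr => h _ (Ideal.mem_map_of_mem _ hr)
  · intro h r hr
    have : Ideal.map (algebraMap R A) (a ^ k) ≤ LinearMap.ker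
      (LinearMap.toSpanSingleton A V y) := by
      rw [Ideal.map_le_iff_le_comap]
      exact h
    exact this hr

lemma mk_mem_powTorsion {a : Ideal R} {x : X} {k : ℕ} {s : S}
    (h : ∀ r ∈ a ^ k, ∃ t ∈ S, t • r • x = 0) :
    LocalizedModule.mk x s ∈ powTorsion (a.map (algebraMap R (Localization S)))
      (LocalizedModule S X) := by
  refine ⟨k, forall_mem_map_pow_smul_eq_zero.mpr fun r hr => ?_⟩
  obtain ⟨t, ht, h0⟩ := h r hr
  rw [algebraMap_smul, LocalizedModule.smul'_mk, ← LocalizedModule.zero_mk s, LocalizedModule.mk_eq]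
  refine ⟨⟨t, ht⟩, ?_⟩
  simp only [smul_zero, Submonoid.smul_def]
  rw [smul_comm, h0, smul_zero]

lemma exists_of_mk_mem_powTorsion [IsNoetherianRing R] {a : Ideal R} {x : X} {s : S}
    (h : LocalizedModule.mk x s ∈
      powTorsion (a.map (algebraMap R (Localization S))) (LocalizedModule S X)) :
    ∃ t ∈ S, t • x ∈ powTorsion a X := by
  obtain ⟨k, hk⟩ := h
  rw [forall_mem_map_pow_smul_eq_zero] at hk
  obtain ⟨t, ht, h0⟩ := exists_smul_eq_zero_of_fg (S := S)
    (P := Submodule.map (LinearMap.toSpanSingleton R X x) (a ^ k))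
    ((IsNoetherian.noetherian (a ^ k)).map _) (by
      rintro _ ⟨r, hr, rfl⟩
      have := hk r hr
      rw [algebraMap_smul, LocalizedModule.smul'_mk, ← LocalizedModule.zero_mk s,
        LocalizedModule.mk_eq] at this
      obtain ⟨t, ht⟩ := this
      refine ⟨t * s, (t * s).2, ?_⟩
      simp only [smul_zero, Submonoid.smul_def] at ht
      rw [mul_smul]
      exact ht)
  refine ⟨t, ht, k, fun r hr => ?_⟩
  rw [smul_comm]
  exact h0 _ ⟨r, hr, rfl⟩

lemma powTorsion_localized_eq_bot [IsNoetherianRing R] {a : Ideal R} (h : powTorsion a X = ⊥) :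
    powTorsion (a.map (algebraMap R (Localization S))) (LocalizedModule S X) = ⊥ := by
  rw [eq_bot_iff]
  intro y hy
  induction y using LocalizedModule.induction_on with
  | h x s =>
    obtain ⟨t, ht, h0⟩ := exists_of_mk_mem_powTorsion S hy
    rw [h, Submodule.mem_bot] at h0
    rw [Submodule.mem_bot, ← LocalizedModule.zero_mk s, LocalizedModule.mk_eq]
    refine ⟨⟨t, ht⟩, ?_⟩
    simp only [smul_zero, Submonoid.smul_def]
    rw [smul_comm, h0, smul_zero]

lemma ker_localized_eq_powTorsion [IsNoetherianRing R] {a : Ideal R} {f : X →ₗ[R] Y}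
    (hY : powTorsion a Y = ⊥)
    (hf : LinearMap.ker f = powTorsion a X) :
    LinearMap.ker (LocalizedModule.map S f) =
      powTorsion (a.map (algebraMap R (Localization S))) (LocalizedModule S X) := by
  apply le_antisymm
  · intro y hy
    induction y using LocalizedModule.induction_on with
    | h x s =>
      rw [LinearMap.mem_ker, LocalizedModule.map_mk, ← LocalizedModule.zero_mk s,
        LocalizedModule.mk_eq] at hy
      obtain ⟨t, ht⟩ := hy
      simp only [smul_zero, Submonoid.smul_def] at ht
      have : ((t * s : S) : R) • x ∈ powTorsion a X := by
        rw [← hf, LinearMap.mem_ker, map_smul, Submonoid.coe_mul, mul_smul, ht]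
      obtain ⟨k, hk⟩ := this
      exact mk_mem_powTorsion S (k := k) fun r hr => ⟨_, (t * s).2, by rw [smul_comm, hk r hr]⟩
  · rintro y ⟨k, hk⟩
    have : LocalizedModule.map S f y ∈
        powTorsion (a.map (algebraMap R (Localization S))) (LocalizedModule S Y) :=
      ⟨k, fun r hr => by rw [← map_smul, hk r hr, map_zero]⟩
    rwa [powTorsion_localized_eq_bot S hY] at this

theorem exists_smul_smul_lc_eq_zero [IsNoetherianRing R] {a : Ideal R} {k : ℕ} (i : ℕ) :
    ∀ (N : Type u) [AddCommGroup N] [Module R N]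
      (_ : ∀ x : lc (a.map (algebraMap R (Localization S))) i
        (ModuleCat.of (Localization S) (LocalizedModule S N)),
        ∀ r ∈ a ^ k, algebraMap R (Localization S) r • x = 0)
      (x : lc a i (ModuleCat.of R N)), ∀ r ∈ a ^ k, ∃ s ∈ S, s • r • x = 0 := by
  induction i with
  | zero =>
    intro N _ _ h x r hr
    obtain ⟨e⟩ := nonempty_lc_zero (X := N) a
    obtain ⟨e'⟩ := nonempty_lc_zero (X := LocalizedModule S N)
      (a.map (algebraMap R (Localization S)))
    obtain ⟨l, hl⟩ := (e x).2
    have hx : LocalizedModule.mk (e x).1 (1 : S) ∈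
        powTorsion (a.map (algebraMap R (Localization S))) (LocalizedModule S N) :=
      mk_mem_powTorsion S (k := l) fun r hr => ⟨1, S.one_mem, by rw [hl r hr, smul_zero]⟩
    have h0 := congrArg e' (h (e'.symm ⟨_, hx⟩) r hr)
    rw [map_smul, LinearEquiv.apply_symm_apply, map_zero] at h0
    have h1 := congrArg Subtype.val h0
    simp only [Submodule.coe_smul, ZeroMemClass.coe_zero] at h1
    rw [algebraMap_smul, LocalizedModule.smul'_mk, ← LocalizedModule.zero_mk (1 : S),
      LocalizedModule.mk_eq] at h1
    obtain ⟨t, ht⟩ := h1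
    simp only [smul_zero, one_smul, Submonoid.smul_def] at ht
    refine ⟨t, t.2, e.injective (Subtype.ext ?_)⟩
    simpa using ht
  | succ i ih =>
    intro N _ _ h x r hr
    obtain ⟨E, _, _, f, hE, hE0, hf⟩ := exists_torsionFree_injective N a
    have hex := LinearMap.exact_map_mkQ_range f
    obtain ⟨e⟩ := nonempty_lc_dimensionShift f (LinearMap.range f).mkQ hf hex
      (Submodule.mkQ_surjective _) hE hE0 i
    have := IsLocalization.isNoetherianRing S (Localization S) inferInstance
    obtain ⟨e'⟩ := nonempty_lc_dimensionShift (R := Localization S) (LocalizedModule.map S f)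
      (LocalizedModule.map S (LinearMap.range f).mkQ) (ker_localized_eq_powTorsion S hE0 hf)
      (LocalizedModule.map_exact S _ _ hex)
      (LocalizedModule.map_surjective S _ (Submodule.mkQ_surjective _))
      (Module.injective_of_isLocalizedModule S (LocalizedModule.mkLinearMap S E))
      (powTorsion_localized_eq_bot S hE0) i
    obtain ⟨s, hs, h0⟩ := ih _ (fun y r hr => e'.symm.injective (by
      rw [map_smul, h _ r hr, map_zero])) (e x) r hr
    exact ⟨s, hs, e.injective (by rw [map_smul, map_smul, h0, map_zero])⟩

end Localization

section AssociatedPrimes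

open Abelian

variable {R : Type u} [CommRing R]

variable {X : Type u} [AddCommGroup X] [Module R X] {Φ : Set (PrimeSpectrum R)}

lemma FGS.of_torsionBySet [IsNoetherianRing R] {a : Ideal R} (k : ℕ) :
    ∀ (X : Type u) [AddCommGroup X] [Module R X],
      FGS Φ (Submodule.torsionBySet R X (a : Set R)) →
      (∀ x : X, ∀ r ∈ a ^ k, ∀ p ∈ Φ, ∃ s ∉ p.asIdeal, s • r • x = 0) → FGS Φ X := by
  induction k with
  | zero =>
    intro X _ _ _ h
    refine ⟨⊥, Submodule.fg_bot, fun x p hp => ?_⟩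
    simpa using h x 1 (by simp) p hp
  | succ k ih =>
    intro X _ _ hX h
    let T : Submodule R X :=
      { carrier := {y | ∀ r ∈ a ^ k, ∀ p ∈ Φ, ∃ s ∉ p.asIdeal, s • r • y = 0}
        zero_mem' := fun r _ p _ => ⟨1, p.2.one_notMem, by simp⟩
        add_mem' := by
          intro x y hx hy r hr p hp
          obtain ⟨s, hs, hs'⟩ := hx r hr p hp
          obtain ⟨t, ht, ht'⟩ := hy r hr p hp
          refine ⟨s * t, fun hh => (p.2.mem_or_mem hh).elim hs ht, ?_⟩
          rw [smul_add, smul_add, mul_smul, mul_smul, ht', smul_comm, hs']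
          simp
        smul_mem' := by
          intro c x hx r hr p hp
          obtain ⟨s, hs, hs'⟩ := hx r hr p hp
          exact ⟨s, hs, by rw [smul_comm r c, smul_comm s c, hs', smul_zero]⟩ }
    have hT : FGS Φ T := ih T
      (FGS.torsionBySet_of_injective (f := T.subtype) Subtype.val_injective hX)
      (fun x r hr p hp => by
        obtain ⟨s, hs, hs'⟩ := x.2 r hr p hp
        exact ⟨s, hs, Subtype.ext hs'⟩)
    obtain ⟨m, g, hg⟩ := Submodule.fg_iff_exists_fin_generating_family.mp
      (IsNoetherian.noetherian a)
    have hga (i : Fin m) : g i ∈ a := hg ▸ Submodule.subset_span ⟨i, rfl⟩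
    let φ : X →ₗ[R] Fin m → T := LinearMap.pi fun i =>
      (LinearMap.lsmul R X (g i)).codRestrict T fun x r hr p hp => by
        simpa [mul_smul] using h x (r * g i) (Ideal.mul_mem_mul hr (hga i)) p hp
    refine FGS.of_exact (f := (Submodule.torsionBySet R X (a : Set R)).subtype) (g := φ)
      (fun x => ?_) hX (hT.pi m)
    have h₁ : φ x = 0 ↔ ∀ i, g i • x = 0 := by
      rw [funext_iff]
      exact forall_congr' fun i => by simp [φ, Subtype.ext_iff]
    have h₂ : x ∈ Set.range (Submodule.torsionBySet R X (a : Set R)).subtype ↔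
        ∀ r ∈ a, r • x = 0 := by
      simp [Submodule.mem_torsionBySet_iff]
    rw [h₁, h₂]
    refine ⟨fun hx r hr => ?_, fun hx i => hx _ (hga i)⟩
    have : a ≤ LinearMap.ker (LinearMap.toSpanSingleton R X x) := by
      rw [← hg, Submodule.span_le]
      rintro _ ⟨i, rfl⟩
      exact hx i
    exact this hr

lemma mem_colon_bot_singleton {X : Type*} [AddCommGroup X] [Module R X]
    {x : X} {r : R} :
    r ∈ Submodule.colon (⊥ : Submodule R X) {x} ↔ r • x = 0 := by
  simp

/-- The associated primes of `X` lying in `Φ`. -/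
def assIn (Φ : Set (PrimeSpectrum R)) (X : Type u) [AddCommGroup X] [Module R X] :
    Set (PrimeSpectrum R) :=
  {p | p ∈ Φ ∧ p.asIdeal ∈ associatedPrimes R X}

lemma le_of_colon_eq {a p : Ideal R} [p.IsPrime] {x : X} (hx : x ∈ powTorsion a X)
    (h : p = Submodule.colon ⊥ {x}) : a ≤ p := by
  obtain ⟨k, hk⟩ := hx
  intro r hr
  refine Ideal.IsPrime.mem_of_pow_mem ‹_› k ?_
  rw [h, mem_colon_bot_singleton]
  exact hk _ (Ideal.pow_mem_pow hr k)

lemma finite_assIn [IsNoetherianRing R] {a : Ideal R} (hX : powTorsion a X = ⊤)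
    (h : FGS Φ (Submodule.torsionBySet R X (a : Set R))) : (assIn Φ X).Finite := by
  obtain ⟨N, hN, hN'⟩ := h
  have : Module.Finite R N := ⟨N.fg_top.mpr hN⟩
  refine Set.Finite.subset ((associatedPrimes.finite R N).preimage
    (f := PrimeSpectrum.asIdeal) (fun _ _ _ _ h => PrimeSpectrum.ext h)) ?_
  rintro p ⟨hp, hp'⟩
  obtain ⟨-, x, hx⟩ := isAssociatedPrime_iff.mp hp'
  have hap : a ≤ p.asIdeal := le_of_colon_eq (x := x) (hX ▸ trivial) hx
  have hxT : x ∈ Submodule.torsionBySet R X (a : Set R) := by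
    rw [Submodule.mem_torsionBySet_iff]
    rintro ⟨r, hr⟩
    exact mem_colon_bot_singleton.mp (hx ▸ hap hr)
  obtain ⟨s, hs, hs'⟩ := hN' ⟨x, hxT⟩ p hp
  refine isAssociatedPrime_iff.mpr ⟨p.2, ⟨_, hs'⟩, ?_⟩
  ext r
  have h₁ : r ∈ Submodule.colon (⊥ : Submodule R N) {⟨_, hs'⟩} ↔ r * s ∈ p.asIdeal := by
    rw [mem_colon_bot_singleton, hx, mem_colon_bot_singleton, mul_smul]
    simp [Subtype.ext_iff]
  rw [h₁]
  exact ⟨fun h => Ideal.mul_mem_right _ _ h, fun h => (p.2.mem_or_mem h).resolve_right hs⟩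

lemma exists_smul_smul_eq_zero_of_assIn [IsNoetherianRing R] {a : Ideal R}
    (hΦ : ∀ p q : PrimeSpectrum R, p ≤ q → q ∈ Φ → p ∈ Φ) (hfin : (assIn Φ X).Finite)
    (h : ∀ p ∈ assIn Φ X, ∃ k : ℕ, ∀ x : X, ∀ r ∈ a ^ k, ∃ s ∉ p.asIdeal, s • r • x = 0) :
    ∃ k : ℕ, ∀ x : X, ∀ r ∈ a ^ k, ∀ p ∈ Φ, ∃ s ∉ p.asIdeal, s • r • x = 0 := by
  choose! k hk using h
  refine ⟨hfin.toFinset.sup k, fun x r hr q hq => ?_⟩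
  by_contra! hcon
  have hle : Submodule.colon (⊥ : Submodule R X) {r • x} ≤ q.asIdeal := fun s hs => by
    by_contra hsq
    exact hcon s hsq (mem_colon_bot_singleton.mp hs)
  obtain ⟨p, hp, hpq⟩ := Ideal.exists_minimalPrimes_le hle
  obtain ⟨z, hz⟩ := Submodule.exists_eq_colon_of_mem_minimalPrimes hp
  have hpΦ : (⟨p, hp.1.1⟩ : PrimeSpectrum R) ∈ assIn Φ X :=
    ⟨hΦ _ q hpq hq, isAssociatedPrime_iff.mpr ⟨hp.1.1, z, hz⟩⟩
  obtain ⟨s, hs, hs'⟩ := hk _ hpΦ x r (Ideal.pow_le_pow_right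
    (Finset.le_sup (f := k) (hfin.mem_toFinset.mpr hpΦ)) hr)
  exact hs (hp.1.2 (mem_colon_bot_singleton.mpr hs'))

end AssociatedPrimes

section Bound

open Abelian

variable {R : Type u} [CommRing R]

variable {X : Type u} [AddCommGroup X] [Module R X] {Φ : Set (PrimeSpectrum R)}

lemma subsingleton_lc [Subsingleton X] (a : Ideal R) (i : ℕ) :
    Subsingleton (lc a i (ModuleCat.of R X)) := by
  refine subsingleton_of_forall_eq 0 fun x => ?_
  obtain ⟨k, y, rfl⟩ := Module.DirectLimit.exists_of x
  have : 𝟙 (ModuleCat.of R X) = 0 := by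
    ext x
    exact Subsingleton.elim (α := X) _ _
  rw [← y.comp_mk₀_id, this, Ext.mk₀_zero, Ext.comp_zero, map_zero]

lemma exists_smul_smul_lc_eq_zero_of_lt_fDimN [IsNoetherianRing R] [Module.Finite R X]
    {a : Ideal R} {n i : ℕ} (hi : (i : ℕ∞) < fDimN R a X n) (p : PrimeSpectrum R)
    (hap : a ≤ p.asIdeal) (hp : (n : WithBot ℕ∞) ≤ ringKrullDim (R ⧸ p.asIdeal)) :
    ∃ k : ℕ, ∀ x : lc a i (ModuleCat.of R X), ∀ r ∈ a ^ k, ∃ s ∉ p.asIdeal, s • r • x = 0 := by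
  suffices h : ∃ k : ℕ, ∀ x : lc (a.map (algebraMap R (Localization p.asIdeal.primeCompl))) i
      (ModuleCat.of (Localization p.asIdeal.primeCompl)
        (LocalizedModule p.asIdeal.primeCompl X)),
      ∀ r ∈ a ^ k, algebraMap R (Localization p.asIdeal.primeCompl) r • x = 0 by
    obtain ⟨k, hk⟩ := h
    exact ⟨k, exists_smul_smul_lc_eq_zero p.asIdeal.primeCompl i X hk⟩
  by_cases hpX : p ∈ Module.support R X
  · have hps : p ∈ Module.support R (X ⧸ (a • ⊤ : Submodule R X)) := by
      rw [Module.support_quotient]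
      exact ⟨hpX, hap⟩
    have hlt := hi.trans_le (sInf_le ⟨p, hps, hp, rfl⟩)
    have hfin : Module.Finite (Localization.AtPrime p.asIdeal)
        ((localCohomology (a.map (algebraMap R (Localization.AtPrime p.asIdeal))) i).obj
          (ModuleCat.of (Localization.AtPrime p.asIdeal)
            (LocalizedModule p.asIdeal.primeCompl X))) := by
      by_contra hcon
      exact notMem_of_lt_csInf' hlt ⟨i, rfl, hcon⟩
    have := Module.Finite.equiv (lcEquiv (a.map (algebraMap R (Localization.AtPrime p.asIdeal))) i
      (ModuleCat.of (Localization.AtPrime p.asIdeal) (LocalizedModule p.asIdeal.primeCompl X)))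
    obtain ⟨k, hk⟩ := exists_pow_smul_eq_zero_of_fg this.fg_top (powTorsion_lc _ _ _).ge
    exact ⟨k, fun x => forall_mem_map_pow_smul_eq_zero.mp fun r hr => hk r hr x trivial⟩
  · have : Subsingleton (LocalizedModule p.asIdeal.primeCompl X) :=
      Module.notMem_support_iff.mp hpX
    have := subsingleton_lc (X := LocalizedModule p.asIdeal.primeCompl X)
      (a.map (algebraMap R (Localization p.asIdeal.primeCompl))) i
    exact ⟨0, fun x r _ => Subsingleton.elim _ _⟩

lemma le_of_mem_assIn [IsNoetherianRing R] {a : Ideal R} (hX : powTorsion a X = ⊤)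
    {p : PrimeSpectrum R}
    (hp : p ∈ assIn Φ X) : a ≤ p.asIdeal := by
  obtain ⟨-, x, hx⟩ := isAssociatedPrime_iff.mp hp.2
  exact le_of_colon_eq (x := x) (hX ▸ trivial) hx

/-- The primes `p` with `dim R/p ≥ n`. -/
def dimGE (R : Type u) [CommRing R] (n : ℕ) : Set (PrimeSpectrum R) :=
  {p | (n : WithBot ℕ∞) ≤ ringKrullDim (R ⧸ p.asIdeal)}

lemma mem_dimGE_of_le {n : ℕ} (p q : PrimeSpectrum R) (hpq : p ≤ q) (hq : q ∈ dimGE R n) :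
    p ∈ dimGE R n :=
  le_trans hq (ringKrullDim_le_of_surjective (Ideal.Quotient.factor hpq)
    (Ideal.Quotient.factor_surjective hpq))

lemma fgs_lc_and_finite_assIn [IsNoetherianRing R] [Module.Finite R X] {a : Ideal R} {n : ℕ}
    (i : ℕ) (hi : (i : ℕ∞) < fDimN R a X n) :
    FGS (dimGE R n) (lc a i (ModuleCat.of R X)) ∧
      (assIn (dimGE R n) (lc a i (ModuleCat.of R X))).Finite := by
  induction i using Nat.strong_induction_on with
  | _ i ih =>
    have htors := fgs_torsionBySet_lc (Φ := dimGE R n) (a := a) i X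
      (fun j _ => FGS.of_finite)
      (fun j hj => (ih j hj (lt_trans (by exact_mod_cast hj) hi)).1)
    have hgam := powTorsion_lc a i (ModuleCat.of R X)
    have hfin := finite_assIn hgam htors
    obtain ⟨k, hk⟩ := exists_smul_smul_eq_zero_of_assIn mem_dimGE_of_le hfin fun p hp =>
      exists_smul_smul_lc_eq_zero_of_lt_fDimN hi p (le_of_mem_assIn hgam hp) hp.1
    exact ⟨FGS.of_torsionBySet k _ htors hk, hfin⟩

open DirectSum in
lemma associatedPrimes_directSum_subset [IsNoetherianRing R] {ι : Type*} [Fintype ι]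
    (T : ι → Type*)
    [∀ i, AddCommGroup (T i)] [∀ i, Module R (T i)] :
    associatedPrimes R (⨁ i, T i) ⊆ ⋃ i, associatedPrimes R (T i) := by
  intro p hp
  obtain ⟨hp, x, hx⟩ := isAssociatedPrime_iff.mp hp
  have hinf : p = Finset.univ.inf fun i => Submodule.colon (⊥ : Submodule R (T i)) {x i} := by
    ext r
    rw [hx]
    simp only [Submodule.mem_finsetInf, mem_colon_bot_singleton, Finset.mem_univ, true_imp_iff]
    exact DFunLike.ext_iff
  obtain ⟨i, -, hi⟩ := hp.inf_le'.mp hinf.ge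
  refine Set.mem_iUnion.mpr ⟨i, isAssociatedPrime_iff.mpr ⟨hp, x i, le_antisymm ?_ hi⟩⟩
  exact hinf.le.trans (Finset.inf_le (Finset.mem_univ i))

end Bound

end AssPrimesFinite

open AssPrimesFinite

open DirectSum in
theorem assPrimes_directSum_lt_finite (R M : Type u) [CommRing R] [IsNoetherianRing R]
    [IsLocalRing R] [IsAdicComplete (IsLocalRing.maximalIdeal R) R]
    [AddCommGroup M] [Module R M] [Module.Finite R M] (a : Ideal R) (n t : ℕ)
    (ht : fDimN R a M n = (t : ℕ∞)) :
    {p ∈ associatedPrimes R (⨁ i : Fin t, ((localCohomology a i.1).obj (ModuleCat.of R M))) |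
      (n : WithBot ℕ∞) ≤ ringKrullDim (R ⧸ p)}.Finite := by
  refine Set.Finite.subset (Set.finite_iUnion fun i : Fin t =>
    ((fgs_lc_and_finite_assIn (X := M) (a := a) (n := n) i.1
      (by rw [ht]; exact_mod_cast i.2)).2.image PrimeSpectrum.asIdeal)) ?_
  rintro p ⟨hp, hpn⟩
  obtain ⟨i, hi⟩ := Set.mem_iUnion.mp (associatedPrimes_directSum_subset _ hp)
  rw [LinearEquiv.AssociatedPrimes.eq (lcEquiv a i.1 (ModuleCat.of R M))] at hi
  exact Set.mem_iUnion.mpr ⟨i, ⟨p, hi.isPrime⟩, ⟨hpn, hi⟩, rfl⟩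
end

section
/- Let (R, m) be a complete Noetherian local ring, a an ideal, M a finitely generated R-module, n a nonnegative integer, and t = f^n_a(M) (assumed finite). Then the set { p ∈ Ass_R(⊕_{i=0}^{t} H^i_a(M)) : dim R/p ≥ n } is finite. In particular, { p ∈ Ass_R(H^t_a(M)) : dim R/p ≥ n } is finite. -/
open CategoryTheory

universe u

namespace CochainComplex
variable {R : Type u} [CommRing R] (K L : CochainComplex (ModuleCat.{u} R) ℕ)

/-- The projection from concrete cocycles onto cohomology. -/
noncomputable def kerToHomology (n : ℕ) :
    LinearMap.ker (K.d n (n + 1)).hom →ₗ[R] K.homology n :=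
  (K.liftCycles (ModuleCat.ofHom (LinearMap.ker (K.d n (n + 1)).hom).subtype) (n + 1)
    (by simp) (by ext x; exact x.2) ≫ K.homologyπ n).hom

variable {K L} in
lemma kerToHomology_naturality (φ : K ⟶ L) (n : ℕ) (x : LinearMap.ker (K.d n (n + 1)).hom)
    (y : LinearMap.ker (L.d n (n + 1)).hom) (h : φ.f n x.1 = y.1) :
    HomologicalComplex.homologyMap φ n (K.kerToHomology n x) = L.kerToHomology n y := by
  have h1 : ∀ v ∈ LinearMap.ker (K.d n (n + 1)).hom,
      (φ.f n).hom v ∈ LinearMap.ker (L.d n (n + 1)).hom := by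
    intro v hv
    have := ConcreteCategory.congr_hom (φ.comm n (n + 1)) v
    simp only [ModuleCat.comp_apply] at this
    rw [LinearMap.mem_ker] at hv ⊢
    rw [this, hv, map_zero]
  have h2 : K.liftCycles (ModuleCat.ofHom (LinearMap.ker (K.d n (n + 1)).hom).subtype) (n + 1)
      (by simp) (by ext x; exact x.2) ≫ HomologicalComplex.cyclesMap φ n =
      ModuleCat.ofHom ((φ.f n).hom.restrict h1) ≫
        L.liftCycles (ModuleCat.ofHom (LinearMap.ker (L.d n (n + 1)).hom).subtype) (n + 1)
      (by simp) (by ext x; exact x.2) := by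
    rw [← cancel_mono (L.iCycles n)]
    simp
    rfl
  have h3 : y = (φ.f n).hom.restrict h1 x := Subtype.ext h.symm
  subst h3
  have := ConcreteCategory.congr_hom (h2 =≫ L.homologyπ n) x
  simp only [Category.assoc, ← HomologicalComplex.homologyπ_naturality] at this
  exact this

lemma kerToHomology_surjective (n : ℕ) : Function.Surjective (K.kerToHomology n) := by
  intro z
  obtain ⟨c, rfl⟩ := (ModuleCat.epi_iff_surjective (K.homologyπ n)).1 inferInstance z
  refine ⟨⟨(K.iCycles n).hom c, ?_⟩, ?_⟩
  · exact ConcreteCategory.congr_hom (K.iCycles_d n (n + 1)) c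
  · simp only [kerToHomology, ModuleCat.hom_comp, LinearMap.comp_apply]
    congr 1
    apply (ModuleCat.mono_iff_injective (K.iCycles n)).1 inferInstance
    exact ConcreteCategory.congr_hom (K.liftCycles_i _ (n + 1) (by simp) _) _

lemma kerToHomology_eq_zero_iff (n : ℕ) (x : LinearMap.ker (K.d n (n + 1)).hom) :
    K.kerToHomology n x = 0 ↔ ∃ y, K.d ((ComplexShape.up ℕ).prev n) n y = x.1 := by
  have hi : Function.Injective (K.iCycles n) :=
    (ModuleCat.mono_iff_injective (K.iCycles n)).1 inferInstance
  have hx := ConcreteCategory.congr_hom (K.liftCycles_i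
    (ModuleCat.ofHom (LinearMap.ker (K.d n (n + 1)).hom).subtype) (n + 1)
    (by simp) (by ext x; exact x.2)) x
  have hex : (ShortComplex.mk _ _ (K.toCycles_comp_homologyπ
      ((ComplexShape.up ℕ).prev n) n)).Exact :=
    ShortComplex.exact_of_g_is_cokernel _ (K.homologyIsCokernel _ n rfl)
  constructor
  · intro h
    obtain ⟨y, hy⟩ := (ShortComplex.moduleCat_exact_iff _).1 hex _ h
    refine ⟨y, ?_⟩
    refine Eq.trans ?_ hx
    refine Eq.trans ?_ (congrArg (K.iCycles n) hy)
    exact (ConcreteCategory.congr_hom (K.toCycles_i ((ComplexShape.up ℕ).prev n) n) y).symm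
  · rintro ⟨y, hy⟩
    have : (K.toCycles ((ComplexShape.up ℕ).prev n) n) y = (K.liftCycles
      (ModuleCat.ofHom (LinearMap.ker (K.d n (n + 1)).hom).subtype) (n + 1)
      (by simp) (by ext x; exact x.2)) x := by
      apply hi
      refine Eq.trans ?_ hx.symm
      exact (ConcreteCategory.congr_hom (K.toCycles_i ((ComplexShape.up ℕ).prev n) n) y).trans hy
    simp only [kerToHomology, ModuleCat.hom_comp, LinearMap.comp_apply]
    erw [← this]
    exact ConcreteCategory.congr_hom (K.toCycles_comp_homologyπ
      ((ComplexShape.up ℕ).prev n) n) y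
end CochainComplex

section
variable {R : Type u} [CommRing R] {X X' : ModuleCat.{u} R} (P : ProjectiveResolution X)
  (P' : ProjectiveResolution X') (Y : ModuleCat.{u} R) (n : ℕ)

/-- The functoriality of `ChainComplex.linearYonedaObj` in the complex. -/
noncomputable def linearYonedaObjMap {P P' : ChainComplex (ModuleCat.{u} R) ℕ} (φ : P' ⟶ P)
    (Y : ModuleCat.{u} R) : P.linearYonedaObj R Y ⟶ P'.linearYonedaObj R Y :=
  (HomologicalComplex.unopFunctor _ _).map
    ((((linearYoneda R _).obj Y).rightOp.mapHomologicalComplex _).map φ).op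

lemma isoExt_naturality {g : X' ⟶ X} (φ : ProjectiveResolution.Hom P' P g) :
    (P.isoExt n Y).inv ≫ ((Ext R (ModuleCat.{u} R) n).map g.op).app Y =
      HomologicalComplex.homologyMap (linearYonedaObjMap φ.hom Y) n ≫ (P'.isoExt n Y).inv := by
  have h := ProjectiveResolution.isoLeftDerivedObj_hom_naturality g P' P φ.hom
    (by simpa using φ.hom_f_zero_comp_π_f_zero) ((linearYoneda R _).obj Y).rightOp n
  have h2 := congrArg Quiver.Hom.unop h
  rw [unop_comp, unop_comp] at h2
  let F := ((linearYoneda R _).obj Y).rightOp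
  have e1 : ((Ext R (ModuleCat.{u} R) n).map g.op).app Y = ((F.leftDerived n).map g).unop := rfl

  have e2 (P : ProjectiveResolution X) : (P.isoExt n Y).inv =
      (HomologicalComplex.homologyUnop _ _).hom ≫
    (P.isoLeftDerivedObj F n).hom.unop := rfl
  have e2' (P : ProjectiveResolution X') : (P.isoExt n Y).inv =
      (HomologicalComplex.homologyUnop _ _).hom ≫
    (P.isoLeftDerivedObj F n).hom.unop := rfl
  rw [e1, e2, e2']
  have := ShortComplex.homologyOpIso_hom_naturality
    ((HomologicalComplex.shortComplexFunctor _ _ n).map (linearYonedaObjMap φ.hom Y))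
  have h3 := congrArg Quiver.Hom.unop this
  exact (Category.assoc _ _ _).trans
    ((congrArg (fun z => (HomologicalComplex.homologyUnop _ _).hom ≫ z) h2).trans
    ((Category.assoc _ _ _).symm.trans
    ((congrArg (fun z => z ≫ (P'.isoLeftDerivedObj F n).hom.unop) h3).trans
    (Category.assoc _ _ _))))
end

section
variable {R : Type u} [CommRing R] {X X' : ModuleCat.{u} R} (P : ProjectiveResolution X)
  (P' : ProjectiveResolution X') (Y : ModuleCat.{u} R) (n : ℕ)

/-- The cocycles `P.X n ⟶ Y` computing `Ext^n(X, Y)` from a projective resolution `P` of `X`. -/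
abbrev extCocycles : Submodule R (P.complex.X n ⟶ Y) :=
  LinearMap.ker ((P.complex.linearYonedaObj R Y).d n (n + 1)).hom

variable {P Y n} in
lemma d_comp_of_mem_extCocycles (f : extCocycles P Y n) : P.complex.d (n + 1) n ≫ f.1 = 0 := f.2

/-- The projection from cocycles onto the derived functor `Ext`. -/
noncomputable def cocyclesToOldExt :
    extCocycles P Y n →ₗ[R] ((Ext R (ModuleCat.{u} R) n).obj (Opposite.op X)).obj Y :=
  (P.isoExt n Y).inv.hom ∘ₗ (P.complex.linearYonedaObj R Y).kerToHomology n

/-- The projection from cocycles onto `Abelian.Ext`. -/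
noncomputable def cocyclesToExt : extCocycles P Y n →ₗ[R] Abelian.Ext X Y n where
  toFun f := P.extMk f.1 (n + 1) rfl (d_comp_of_mem_extCocycles f)
  map_add' f g := (P.add_extMk _ _ _ _ _ _).symm
  map_smul' r f := by
    rw [RingHom.id_apply, Abelian.Ext.smul_eq_comp_mk₀, P.extMk_comp_mk₀]
    congr 1

lemma cocyclesToOldExt_surjective : Function.Surjective (cocyclesToOldExt P Y n) :=
  ((P.isoExt n Y).symm.toLinearEquiv.surjective).comp (CochainComplex.kerToHomology_surjective _ n)

lemma cocyclesToExt_surjective : Function.Surjective (cocyclesToExt P Y n) := by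
  intro x
  obtain ⟨f, hf, rfl⟩ := P.extMk_surjective x (n + 1) rfl
  exact ⟨⟨f, hf⟩, rfl⟩

lemma cocyclesToOldExt_eq_zero_iff (f : extCocycles P Y n) :
    cocyclesToOldExt P Y n f = 0 ↔
      ∃ g : P.complex.X ((ComplexShape.up ℕ).prev n) ⟶ Y, P.complex.d n _ ≫ g = f.1 :=
  ((P.isoExt n Y).symm.toLinearEquiv.map_eq_zero_iff).trans
    (CochainComplex.kerToHomology_eq_zero_iff (P.complex.linearYonedaObj R Y) n f)

open CochainComplex HomComplex in
lemma CategoryTheory.ProjectiveResolution.extMk_zero_eq_zero_iff (f : P.complex.X 0 ⟶ Y)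
    (hf : P.complex.d 1 0 ≫ f = 0) : P.extMk f 1 rfl hf = 0 ↔ f = 0 := by
  simp only [← P.extEquivCohomologyClass.apply_eq_iff_eq,
    ProjectiveResolution.extEquivCohomologyClass_extMk,
    ProjectiveResolution.extEquivCohomologyClass_zero,
    CohomologyClass.mk_eq_zero_iff]
  rw [Cocycle.toSingleMk_mem_coboundaries_iff _ _ _ _ _ 1 (by lia)]
  constructor
  · rintro ⟨g, hg⟩
    have h0 : Limits.IsZero (P.cochainComplex.X 1) :=
      CochainComplex.isZero_of_isStrictlyLE _ 0 1 (by lia)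
    rw [h0.eq_of_src g 0, Limits.comp_zero] at hg
    rw [← cancel_epi (P.cochainComplexXIso (-(0 : ℕ)) 0 rfl).hom, ← hg, Limits.comp_zero]
  · rintro rfl
    exact ⟨0, by simp⟩

lemma cocyclesToExt_eq_zero_iff (f : extCocycles P Y n) :
    cocyclesToExt P Y n f = 0 ↔
      ∃ g : P.complex.X ((ComplexShape.up ℕ).prev n) ⟶ Y, P.complex.d n _ ≫ g = f.1 := by
  cases n with
  | zero =>
    refine (P.extMk_zero_eq_zero_iff Y f.1 (d_comp_of_mem_extCocycles f)).trans ?_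
    simp [eq_comm]
  | succ p =>
    rw [CochainComplex.prev_nat_succ]
    exact P.extMk_eq_zero_iff f.1 _ rfl (d_comp_of_mem_extCocycles f) p rfl

/-- The derived functor `Ext` agrees with `Abelian.Ext`. -/
noncomputable def extComparison :
    ((Ext R (ModuleCat.{u} R) n).obj (Opposite.op X)).obj Y ≃ₗ[R]
      Abelian.Ext X Y n :=
  ((cocyclesToOldExt P Y n).quotKerEquivOfSurjective (cocyclesToOldExt_surjective P Y n)).symm ≪≫ₗ
  Submodule.quotEquivOfEq _ _ (by
    ext f
    rw [LinearMap.mem_ker, LinearMap.mem_ker, cocyclesToExt_eq_zero_iff,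
      cocyclesToOldExt_eq_zero_iff]) ≪≫ₗ
  ((cocyclesToExt P Y n).quotKerEquivOfSurjective (cocyclesToExt_surjective P Y n))

lemma extComparison_cocyclesToOldExt (f : extCocycles P Y n) :
    extComparison P Y n (cocyclesToOldExt P Y n f) = cocyclesToExt P Y n f := by
  have :
      ((cocyclesToOldExt P Y n).quotKerEquivOfSurjective (cocyclesToOldExt_surjective P Y n)).symm
      (cocyclesToOldExt P Y n f) = Submodule.Quotient.mk f := by
    rw [LinearEquiv.symm_apply_eq]; rfl
  simp only [extComparison, LinearEquiv.trans_apply, this]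
  rfl

lemma extComparison_naturality (g : X' ⟶ X)
    (x : ((Ext R (ModuleCat.{u} R) n).obj (Opposite.op X)).obj Y) :
    extComparison P' Y n (((Ext R (ModuleCat.{u} R) n).map g.op).app Y x) =
      (Abelian.Ext.mk₀ g).comp (extComparison P Y n x) (zero_add n) := by
  obtain ⟨f, rfl⟩ := cocyclesToOldExt_surjective P Y n x
  let φ : ProjectiveResolution.Hom P' P g :=
    ⟨ProjectiveResolution.lift g P' P, ProjectiveResolution.lift_commutes_zero g P' P⟩
  have hf : φ.hom.f n ≫ f.1 ∈ extCocycles P' Y n := by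
    change P'.complex.d (n + 1) n ≫ φ.hom.f n ≫ f.1 = 0
    rw [← φ.hom.comm_assoc, d_comp_of_mem_extCocycles, Limits.comp_zero]
  have h1 : ((Ext R (ModuleCat.{u} R) n).map g.op).app Y (cocyclesToOldExt P Y n f) =
      cocyclesToOldExt P' Y n ⟨_, hf⟩ := by
    refine (ConcreteCategory.congr_hom (isoExt_naturality P P' Y n φ) _).trans ?_
    exact congrArg (P'.isoExt n Y).inv.hom
      (CochainComplex.kerToHomology_naturality (linearYonedaObjMap φ.hom Y) n f ⟨_, hf⟩ rfl)
  rw [h1, extComparison_cocyclesToOldExt, extComparison_cocyclesToOldExt]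
  exact (ProjectiveResolution.mk₀_comp_extMk f.1 (n + 1) rfl (d_comp_of_mem_extCocycles f) φ).symm
end

/-- An injective resolution presented as a chain of short exact sequences
`0 → Z i → E i → Z (i + 1) → 0` with every `E i` injective. -/
structure InjectiveChain (R : Type u) [CommRing R] where
  /-- the syzygies -/
  Z : ℕ → ModuleCat.{u} R
  /-- the injective modules -/
  E : ℕ → ModuleCat.{u} R
  /-- the inclusions -/
  ι (i : ℕ) : Z i →ₗ[R] E i
  /-- the projections -/
  π (i : ℕ) : E i →ₗ[R] Z (i + 1)
  ι_injective (i : ℕ) : Function.Injective (ι i)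
  π_surjective (i : ℕ) : Function.Surjective (π i)
  exact (i : ℕ) : Function.Exact (ι i) (π i)
  injective (i : ℕ) : Module.Injective R (E i)

namespace InjectiveChain

section
variable {R : Type u} [CommRing R]

lemma exists_embedding (M : ModuleCat.{u} R) :
    ∃ (E : ModuleCat.{u} R) (f : M →ₗ[R] E), Function.Injective f ∧ Module.Injective R E := by
  refine ⟨Injective.under M, (Injective.ι M).hom,
    (ModuleCat.mono_iff_injective (Injective.ι M)).1 inferInstance, ?_⟩
  have : Injective (ModuleCat.of R (Injective.under M : ModuleCat.{u} R)) :=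
    inferInstanceAs (Injective (Injective.under M))
  exact Module.injective_module_of_injective_object R _

/-- An injective module containing `M`. -/
noncomputable def hull (M : ModuleCat.{u} R) : ModuleCat.{u} R := (exists_embedding M).choose

/-- The embedding of `M` into `hull M`. -/
noncomputable def toHull (M : ModuleCat.{u} R) : M →ₗ[R] hull M :=
  (exists_embedding M).choose_spec.choose

/-- The iterated cosyzygies of `M`. -/
noncomputable def cosyzygy (M : ModuleCat.{u} R) : ℕ → ModuleCat.{u} R
  | 0 => M
  | n + 1 => ModuleCat.of R (hull (cosyzygy M n) ⧸ LinearMap.range (toHull (cosyzygy M n)))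

/-- An injective chain starting at `M`. -/
noncomputable def ofModule (M : ModuleCat.{u} R) : InjectiveChain R where
  Z := cosyzygy M
  E i := hull (cosyzygy M i)
  ι i := toHull (cosyzygy M i)
  π i := (LinearMap.range (toHull (cosyzygy M i))).mkQ
  ι_injective i := (exists_embedding (cosyzygy M i)).choose_spec.choose_spec.1
  π_surjective _ := Submodule.mkQ_surjective _
  exact _ := LinearMap.exact_map_mkQ_range _
  injective i := (exists_embedding (cosyzygy M i)).choose_spec.choose_spec.2

variable (C : InjectiveChain R)

/-- The `i`-th short complex of an injective chain. -/
def shortComplex (i : ℕ) : ShortComplex (ModuleCat.{u} R) :=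
  ShortComplex.mk (ModuleCat.ofHom (C.ι i)) (ModuleCat.ofHom (C.π i))
    (by ext x; exact (C.exact i).apply_apply_eq_zero x)

lemma shortExact (i : ℕ) : (C.shortComplex i).ShortExact where
  exact := (ShortComplex.ShortExact.moduleCat_exact_iff_function_exact _).2 (C.exact i)
  mono_f := (ModuleCat.mono_iff_injective _).2 (C.ι_injective i)
  epi_g := (ModuleCat.epi_iff_surjective _).2 (C.π_surjective i)

instance (i : ℕ) : Injective (C.shortComplex i).X₂ :=
  have := C.injective i
  Module.injective_object_of_injective_module R (C.E i)

open Abelian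

/-- The Yoneda class of the exact sequence `0 → Z 0 → E 0 → ⋯ → E (n - 1) → Z n → 0`. -/
noncomputable def extClass : ∀ n : ℕ, Ext (C.Z n) (C.Z 0) n
  | 0 => Ext.mk₀ (𝟙 _)
  | n + 1 => (C.shortExact n).extClass.comp (extClass n) (add_comm 1 n)

lemma comp_extClass_succ {X : ModuleCat.{u} R} {q n m : ℕ} (h : q + (n + 1) = m)
    (x : Ext X (C.Z (n + 1)) q) :
    x.comp (C.extClass (n + 1)) h =
      Ext.comp (Ext.comp x (C.shortExact n).extClass rfl) (C.extClass n) (by lia) :=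
  (Ext.comp_assoc x _ _ rfl (add_comm 1 n) (by lia)).symm

lemma exists_comp_extClass_eq {X : ModuleCat.{u} R} {q n m : ℕ} (h : q + n = m)
    (y : Ext X (C.Z 0) m) : ∃ x : Ext X (C.Z n) q, x.comp (C.extClass n) h = y := by
  induction n generalizing q m with
  | zero =>
    obtain rfl : q = m := h
    exact ⟨y, Ext.comp_mk₀_id y⟩
  | succ n ih =>
    obtain ⟨x', rfl⟩ := ih (q := q + 1) (by lia) y
    obtain ⟨x, rfl⟩ := Ext.covariant_sequence_exact₁ X (C.shortExact n) x'
      (Ext.eq_zero_of_injective (I := (C.shortComplex n).X₂) _) rfl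
    exact ⟨x, C.comp_extClass_succ h x⟩

lemma eq_zero_of_comp_extClass_eq_zero {X : ModuleCat.{u} R} {q n m : ℕ} (h : (q + 1) + n = m)
    (x : Ext X (C.Z n) (q + 1)) (hx : x.comp (C.extClass n) h = 0) : x = 0 := by
  induction n generalizing q m with
  | zero =>
    obtain rfl : q + 1 = m := h
    exact (Ext.comp_mk₀_id x).symm.trans hx
  | succ n ih =>
    rw [comp_extClass_succ] at hx
    obtain ⟨x₂, rfl⟩ := Ext.covariant_sequence_exact₃ X (C.shortExact n) x rfl (ih _ _ hx)
    rw [Ext.eq_zero_of_injective (I := (C.shortComplex n).X₂) x₂]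
    exact Ext.zero_comp X _ (Ext.mk₀ (C.shortComplex n).g) _ _

/-- The connecting map `Hom(X, Z n) → Ext^n(X, Z 0)`. -/
noncomputable def homToExt (X : ModuleCat.{u} R) (n : ℕ) : (X ⟶ C.Z n) →ₗ[R] Ext X (C.Z 0) n where
  toFun f := (Ext.mk₀ f).comp (C.extClass n) (zero_add n)
  map_add' f g := by rw [Ext.mk₀_add, Ext.add_comp]
  map_smul' r f := by rw [Ext.mk₀_smul, Ext.smul_comp]; rfl

lemma homToExt_comp {X X' : ModuleCat.{u} R} (n : ℕ) (g : X' ⟶ X) (f : X ⟶ C.Z n) :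
    C.homToExt X' n (g ≫ f) = (Ext.mk₀ g).comp (C.homToExt X n f) (zero_add n) := by
  change (Ext.mk₀ (g ≫ f)).comp _ (zero_add n) = _
  rw [← Ext.mk₀_comp_mk₀, Ext.comp_assoc _ _ _ _ (zero_add n) (by lia)]; rfl

lemma homToExt_surjective (X : ModuleCat.{u} R) (n : ℕ) :
    Function.Surjective (C.homToExt X n) := by
  intro y
  obtain ⟨x, hx⟩ := C.exists_comp_extClass_eq (q := 0) (zero_add n) y
  obtain ⟨f, rfl⟩ := Ext.addEquiv₀.symm.surjective x
  exact ⟨f, hx⟩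

lemma homToExt_zero_injective (X : ModuleCat.{u} R) : Function.Injective (C.homToExt X 0) := by
  intro f g h
  have h' := (Ext.comp_mk₀_id (Ext.mk₀ f)).symm.trans (h.trans (Ext.comp_mk₀_id (Ext.mk₀ g)))
  exact (Ext.mk₀_bijective _ _).1 h'

lemma homToExt_succ_eq_zero_iff (X : ModuleCat.{u} R) (n : ℕ) (f : X ⟶ C.Z (n + 1)) :
    C.homToExt X (n + 1) f = 0 ↔ ∃ e : X ⟶ C.E n, e ≫ ModuleCat.ofHom (C.π n) = f := by
  have key : (C.homToExt X (n + 1)) f =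
    Ext.comp (Ext.comp (Ext.mk₀ f) (C.shortExact n).extClass rfl) (C.extClass n) (by lia) :=
      C.comp_extClass_succ (zero_add (n + 1)) _
  rw [key]
  constructor
  · intro h
    obtain ⟨x₂, h₂⟩ := Ext.covariant_sequence_exact₃ X (C.shortExact n) (Ext.mk₀ f) rfl
      (C.eq_zero_of_comp_extClass_eq_zero (q := 0) _ _ h)
    obtain ⟨e, rfl⟩ := Ext.addEquiv₀.symm.surjective x₂
    refine ⟨e, (Ext.mk₀_bijective _ _).1 ?_⟩
    exact (Ext.mk₀_comp_mk₀ e (C.shortComplex n).g).symm.trans h₂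
  · rintro ⟨e, rfl⟩
    have h : ∀ e : X ⟶ (C.shortComplex n).X₂,
        Ext.comp (Ext.mk₀ (e ≫ (C.shortComplex n).g)) (C.shortExact n).extClass
          (zero_add 1) = 0 := by
      intro e
      rw [← Ext.mk₀_comp_mk₀, Ext.comp_assoc_of_second_deg_zero, (C.shortExact n).comp_extClass,
        Ext.comp_zero]
    refine Eq.trans (congrArg (fun z ↦ Ext.comp z (C.extClass n) (add_comm 1 n)) (h e)) ?_
    exact Ext.zero_comp X _ (C.extClass n) _ _
end
end InjectiveChain

section
open Limits Opposite

namespace localCohomology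
variable {R : Type u} [CommRing R] (a : Ideal R)

/-- The quotient map `R ⧸ a ^ l ⟶ R ⧸ a ^ k` for `k ≤ l`. -/
noncomputable abbrev quotPowMap {k l : ℕ} (h : k ≤ l) :
    ModuleCat.of R (R ⧸ a ^ l) ⟶ ModuleCat.of R (R ⧸ a ^ k) :=
  ModuleCat.ofHom (Submodule.mapQ _ _ LinearMap.id (Ideal.pow_le_pow_right h))

lemma exists_oldExt (n : ℕ) (M : ModuleCat.{u} R) :
    ∃ J : ∀ k : ℕ, ((Ext R (ModuleCat.{u} R) n).obj (op (ModuleCat.of R (R ⧸ a ^ k)))).obj M →ₗ[R]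
      ((localCohomology a n).obj M),
      (∀ (k l : ℕ) (h : k ≤ l) x,
        J l (((Ext R (ModuleCat.{u} R) n).map (quotPowMap a h).op).app M x) = J k x) ∧
      (∀ y, ∃ k x, J k x = y) ∧
      ∀ k x, J k x = 0 → ∃ l, ∃ h : k ≤ l,
        ((Ext R (ModuleCat.{u} R) n).map (quotPowMap a h).op).app M x = 0 := by
  have : HasColimit (diagram (idealPowersDiagram a) n) := hasColimitDiagram _ n
  let F := diagram (idealPowersDiagram a) n
  let c := ((evaluation (ModuleCat.{u} R) (ModuleCat.{u} R)).obj M).mapCocone (colimit.cocone F)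
  have hc : IsColimit c := isColimitOfPreserves _ (colimit.isColimit F)
  have : IsFiltered ℕᵒᵖᵒᵖ := inferInstance
  have : PreservesFilteredColimitsOfSize.{0, 0} (forget (ModuleCat.{u} R)) :=
    preservesFilteredColimitsOfSize_shrink.{0, u, 0, u} _
  have : PreservesColimit (F ⋙ (evaluation (ModuleCat.{u} R) (ModuleCat.{u} R)).obj M)
      (forget (ModuleCat.{u} R)) :=
    inferInstance
  refine ⟨fun k ↦ (c.ι.app (op (op k))).hom, ?_, ?_, ?_⟩
  · intro k l h x
    exact ConcreteCategory.congr_hom (c.w (homOfLE h).op.op) x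
  · intro y
    obtain ⟨k, x, hx⟩ := Concrete.isColimit_exists_rep _ hc y
    exact ⟨k.unop.unop, x, hx⟩
  · intro k x hx
    obtain ⟨l, f, g, hf⟩ := Concrete.isColimit_exists_of_rep_eq _ hc
      (i := op (op k)) (j := op (op k)) x 0
      (hx.trans (map_zero (c.ι.app (op (op k))).hom).symm)
    refine ⟨l.unop.unop, f.unop.unop.down.down, ?_⟩
    exact hf.trans (map_zero _)
end localCohomology

end

section
open Limits Opposite

/-- The `a`-power torsion submodule `Γ_a(N)`. -/
def gammaSubmodule {R : Type*} [CommRing R] (a : Ideal R) (N : Type*) [AddCommGroup N]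
    [Module R N] :
    Submodule R N where
  carrier := {x | ∃ k : ℕ, ∀ c ∈ a ^ k, c • x = 0}
  add_mem' := by
    rintro x y ⟨k, hk⟩ ⟨l, hl⟩
    refine ⟨k + l, fun c hc ↦ ?_⟩
    rw [smul_add, hk c (Ideal.pow_le_pow_right (Nat.le_add_right k l) hc),
      hl c (Ideal.pow_le_pow_right (Nat.le_add_left l k) hc), add_zero]
  zero_mem' := ⟨0, fun c _ ↦ smul_zero c⟩
  smul_mem' := by
    rintro r x ⟨k, hk⟩
    exact ⟨k, fun c hc ↦ by rw [smul_comm, hk c hc, smul_zero]⟩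

lemma LinearMap.map_mem_gammaSubmodule {R : Type*} [CommRing R] {a : Ideal R} {N N' : Type*}
    [AddCommGroup N] [Module R N] [AddCommGroup N'] [Module R N'] (f : N →ₗ[R] N') {x : N}
    (hx : x ∈ gammaSubmodule a N) : f x ∈ gammaSubmodule a N' := by
  obtain ⟨k, hk⟩ := hx
  exact ⟨k, fun c hc ↦ by rw [← map_smul, hk c hc, map_zero]⟩

namespace InjectiveChain
variable {R : Type u} [CommRing R] (C : InjectiveChain R) (a : Ideal R)

/-- The coboundaries in `Γ_a(Z n)`: the image of `Γ_a(E (n - 1))`. -/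
noncomputable def boundary : ∀ n : ℕ, Submodule R (C.Z n)
  | 0 => ⊥
  | n + 1 => (gammaSubmodule a (C.E n)).map (C.π n)

end InjectiveChain

section
variable {R : Type u} [CommRing R] {a : Ideal R}

lemma exists_hom_quot_pow {N : ModuleCat.{u} R} {k : ℕ} {x : N} (hx : ∀ c ∈ a ^ k, c • x = 0) :
    ∃ f : ModuleCat.of R (R ⧸ a ^ k) ⟶ N, f (1 : R ⧸ a ^ k) = x := by
  refine ⟨ModuleCat.ofHom (Submodule.liftQ _ (LinearMap.toSpanSingleton R N x) ?_), ?_⟩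
  · intro c hc
    exact hx c hc
  · exact (Submodule.liftQ_apply _ _ _).trans (one_smul R x)

lemma hom_quot_pow_ext {N : ModuleCat.{u} R} {k : ℕ} {f g : ModuleCat.of R (R ⧸ a ^ k) ⟶ N}
    (h : f (1 : R ⧸ a ^ k) = g (1 : R ⧸ a ^ k)) : f = g := by
  refine ModuleCat.hom_ext (LinearMap.ext fun x ↦ ?_)
  obtain ⟨r, rfl⟩ := Ideal.Quotient.mk_surjective x
  have h1 : (Ideal.Quotient.mk (a ^ k) r) = r • (1 : R ⧸ a ^ k) := by
    rw [Algebra.smul_def, mul_one]; rfl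
  have h2 := map_smul f.hom r (1 : R ⧸ a ^ k)
  have h3 := map_smul g.hom r (1 : R ⧸ a ^ k)
  rw [h1]
  exact h2.trans ((congrArg (r • ·) h).trans h3.symm)

lemma hom_quot_pow_one_torsion {N : ModuleCat.{u} R} {k : ℕ} (f : ModuleCat.of R (R ⧸ a ^ k) ⟶ N)
    (c : R) (hc : c ∈ a ^ k) : c • f (1 : R ⧸ a ^ k) = 0 := by
  have h1 : c • (1 : R ⧸ a ^ k) = 0 := by
    rw [Algebra.smul_def, mul_one]; exact Ideal.Quotient.eq_zero_iff_mem.2 hc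
  refine (map_smul f.hom c (1 : R ⧸ a ^ k)).symm.trans ?_
  exact (congrArg f.hom h1).trans (map_zero f.hom)
end

namespace InjectiveChain
variable {R : Type u} [CommRing R] (C : InjectiveChain R) (a : Ideal R)
open localCohomology

lemma exists_homToLocalCohomology (n : ℕ) :
    ∃ J : ∀ k : ℕ, (ModuleCat.of R (R ⧸ a ^ k) ⟶ C.Z n) →ₗ[R]
      ((localCohomology a n).obj (C.Z 0)),
      (∀ (k l : ℕ) (h : k ≤ l) f, J l (quotPowMap a h ≫ f) = J k f) ∧
      (∀ y, ∃ k f, J k f = y) ∧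
      ∀ k f, J k f = 0 ↔ ∃ l, ∃ h : k ≤ l, C.homToExt _ n (quotPowMap a h ≫ f) = 0 := by
  obtain ⟨J, h₁, h₂, h₃⟩ := exists_oldExt a n (C.Z 0)
  let P (k : ℕ) := projectiveResolution (ModuleCat.of R (R ⧸ a ^ k))
  have hJ : ∀ (k l : ℕ) (h : k ≤ l) x,
      J l ((extComparison (P l) (C.Z 0) n).symm
        ((Abelian.Ext.mk₀ (quotPowMap a h)).comp x (zero_add n)))
       = J k ((extComparison (P k) (C.Z 0) n).symm x) := by
    intro k l h x
    rw [← h₁ k l h]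
    congr 1
    rw [LinearEquiv.symm_apply_eq, extComparison_naturality (P k) (P l),
      LinearEquiv.apply_symm_apply]
  refine ⟨fun k ↦ J k ∘ₗ (extComparison (P k) (C.Z 0) n).symm.toLinearMap ∘ₗ C.homToExt _ n,
    ?_, ?_, ?_⟩
  · intro k l h f
    exact (congrArg (fun z ↦ J l ((extComparison (P l) (C.Z 0) n).symm z))
      (C.homToExt_comp n (quotPowMap a h) f)).trans (hJ k l h _)
  · intro y
    obtain ⟨k, x, rfl⟩ := h₂ y
    obtain ⟨f, hf⟩ := C.homToExt_surjective _ n (extComparison (P k) (C.Z 0) n x)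
    refine ⟨k, f, ?_⟩
    refine (congrArg (fun z ↦ J k ((extComparison (P k) (C.Z 0) n).symm z)) hf).trans ?_
    exact congrArg (J k) (LinearEquiv.symm_apply_apply _ _)
  · intro k f
    constructor
    · intro h
      obtain ⟨l, hl, h'⟩ := h₃ k _ h
      refine ⟨l, hl, ?_⟩
      rw [homToExt_comp]
      have := extComparison_naturality (P k) (P l) (C.Z 0) n (quotPowMap a hl)
        ((extComparison (P k) (C.Z 0) n).symm (C.homToExt _ n f))
      rw [LinearEquiv.apply_symm_apply] at this
      rw [← this]
      exact (congrArg _ h').trans (map_zero _)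
    · rintro ⟨l, hl, h'⟩
      refine (hJ k l hl _).symm.trans ?_
      rw [← homToExt_comp, h', map_zero, map_zero]

lemma homToExt_eq_zero_iff_of_quot_pow (n : ℕ) (k : ℕ) (f : ModuleCat.of R (R ⧸ a ^ k) ⟶ C.Z n) :
    (∃ l, ∃ h : k ≤ l, C.homToExt _ n (quotPowMap a h ≫ f) = 0) ↔
      f (1 : R ⧸ a ^ k) ∈ C.boundary a n := by
  cases n with
  | zero =>
    refine Iff.trans ?_ (Submodule.mem_bot R).symm
    constructor
    · rintro ⟨l, hl, h⟩
      have := C.homToExt_zero_injective _ (h.trans (map_zero _).symm)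
      exact ConcreteCategory.congr_hom this (1 : R ⧸ a ^ l)
    · intro h
      refine ⟨k, le_rfl, ?_⟩
      rw [show f = 0 from hom_quot_pow_ext h, comp_zero, map_zero]
  | succ n =>
    constructor
    · rintro ⟨l, hl, h⟩
      obtain ⟨e, he⟩ := (C.homToExt_succ_eq_zero_iff _ n _).1 h
      exact ⟨e (1 : R ⧸ a ^ l), ⟨l, hom_quot_pow_one_torsion e⟩,
        ConcreteCategory.congr_hom he (1 : R ⧸ a ^ l)⟩
    · rintro ⟨e, ⟨l, hl⟩, he⟩
      obtain ⟨g, hg⟩ := exists_hom_quot_pow (N := C.E n) (k := max k l) (x := e)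
        fun c hc ↦ hl c (Ideal.pow_le_pow_right (le_max_right k l) hc)
      refine ⟨max k l, le_max_left k l, (C.homToExt_succ_eq_zero_iff _ n _).2 ⟨g, ?_⟩⟩
      refine hom_quot_pow_ext ?_
      exact (congrArg (C.π n) hg).trans he

/-- Local cohomology as the quotient of `Γ_a(Z n)` by the coboundaries. -/
theorem exists_gammaToLocalCohomology (n : ℕ) :
    ∃ θ : gammaSubmodule a (C.Z n) →ₗ[R] ((localCohomology a n).obj (C.Z 0)),
      Function.Surjective θ ∧ ∀ x, θ x = 0 ↔ x.1 ∈ C.boundary a n := by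
  obtain ⟨J, h₁, h₂, h₃⟩ := C.exists_homToLocalCohomology a n
  have key : ∀ (k l : ℕ) (f : ModuleCat.of R (R ⧸ a ^ k) ⟶ C.Z n)
      (g : ModuleCat.of R (R ⧸ a ^ l) ⟶ C.Z n), f (1 : R ⧸ a ^ k) = g (1 : R ⧸ a ^ l) →
      J k f = J l g := by
    intro k l f g h
    rw [← h₁ k (max k l) (le_max_left k l), ← h₁ l (max k l) (le_max_right k l)]
    exact congrArg _ (hom_quot_pow_ext h)
  have ex : ∀ x : gammaSubmodule a (C.Z n), ∃ (k : ℕ) (f : ModuleCat.of R (R ⧸ a ^ k) ⟶ C.Z n),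
      f (1 : R ⧸ a ^ k) = x.1 := fun x ↦ ⟨_, exists_hom_quot_pow x.2.choose_spec⟩
  choose κ φ hφ using ex
  refine ⟨⟨⟨fun x ↦ J (κ x) (φ x), ?_⟩, ?_⟩, ?_, ?_⟩
  · intro x y
    rw [← h₁ (κ x) (max (κ x) (κ y)) (le_max_left _ _),
      ← h₁ (κ y) (max (κ x) (κ y)) (le_max_right _ _),
      ← map_add]
    refine key _ _ _ _ ((hφ _).trans ?_)
    exact (congrArg₂ (· + ·) (hφ x) (hφ y)).symm
  · intro r x
    simp only [RingHom.id_apply]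
    rw [← map_smul]
    refine key _ _ _ _ ((hφ _).trans ?_)
    exact (congrArg (r • ·) (hφ x)).symm
  · intro y
    obtain ⟨k, f, rfl⟩ := h₂ y
    exact ⟨⟨f (1 : R ⧸ a ^ k), k, hom_quot_pow_one_torsion f⟩, key _ _ _ _ (hφ _)⟩
  · intro x
    refine (h₃ _ _).trans ?_
    rw [homToExt_eq_zero_iff_of_quot_pow, hφ]

end InjectiveChain

end

section
open Limits Opposite

section
variable {R : Type u} [CommRing R]

lemma Submodule.FG.exists_map_eq {M N : Type*} [AddCommGroup M] [Module R M] [AddCommGroup N]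
    [Module R N] (g : M →ₗ[R] N) {P : Submodule R N} (hP : P.FG) (h : P ≤ LinearMap.range g) :
    ∃ Q : Submodule R M, Q.FG ∧ Q.map g = P := by
  obtain ⟨s, rfl⟩ := hP
  have hs : ∀ x : s, ∃ y, g y = x.1 := fun x ↦ h (Submodule.subset_span x.2)
  choose y hy using hs
  refine ⟨Submodule.span R (Set.range y), Submodule.fg_span (Set.finite_range y), ?_⟩
  rw [Submodule.map_span, ← Set.range_comp]
  congr 1
  ext z
  constructor
  · rintro ⟨x, rfl⟩
    exact Set.mem_of_eq_of_mem (hy x) x.2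
  · exact fun hz ↦ ⟨⟨z, hz⟩, hy _⟩

/-- `M` is finitely generated up to modules vanishing at all primes of `W`: some finitely
generated submodule `N` of `M` has `(M ⧸ N)_p = 0` for all `p ∈ W`. -/
def FiniteModulo (W : Set (PrimeSpectrum R)) (M : Type*) [AddCommGroup M] [Module R M] : Prop :=
  ∃ N : Submodule R M, N.FG ∧ ∀ p ∈ W, ∀ m : M, ∃ s ∉ p.asIdeal, s • m ∈ N

namespace FiniteModulo
variable (W : Set (PrimeSpectrum R)) {M M' M'' : Type*} [AddCommGroup M] [Module R M]
  [AddCommGroup M'] [Module R M'] [AddCommGroup M''] [Module R M'']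

variable {W}

lemma of_finite [Module.Finite R M] : FiniteModulo W M :=
  ⟨⊤, Module.Finite.fg_top, fun p _ _ ↦ ⟨1, p.isPrime.one_notMem, trivial⟩⟩

lemma of_exact [IsNoetherianRing R] {f : M' →ₗ[R] M} {g : M →ₗ[R] M''}
    (h : ∀ x, g x = 0 → ∃ y, f y = x)
    (h' : FiniteModulo W M') (h'' : FiniteModulo W M'') : FiniteModulo W M := by
  obtain ⟨N', hN', hp'⟩ := h'
  obtain ⟨N'', hN'', hp''⟩ := h''
  have : IsNoetherian R N'' := isNoetherian_of_fg_of_noetherian _ hN''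
  have hfg : (N'' ⊓ LinearMap.range g).FG := Submodule.FG.of_le hN'' inf_le_left
  obtain ⟨N₂, hN₂, hg⟩ := hfg.exists_map_eq g inf_le_right
  refine ⟨N'.map f ⊔ N₂, (hN'.map f).sup hN₂, fun p hp m ↦ ?_⟩
  obtain ⟨s, hs, hsm⟩ := hp'' p hp (g m)
  have : s • g m ∈ N₂.map g := hg ▸ ⟨hsm, s • m, map_smul g s m⟩
  obtain ⟨m₂, hm₂, he⟩ := this
  obtain ⟨m', hm'⟩ := h (s • m - m₂) (by rw [map_sub, map_smul, he, sub_self])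
  obtain ⟨s', hs', hsm'⟩ := hp' p hp m'
  refine ⟨s' * s, fun hmem ↦ (p.isPrime.mem_or_mem hmem).elim hs' hs, ?_⟩
  have : (s' * s) • m = f (s' • m') + s' • m₂ := by
    rw [map_smul, hm', smul_sub, mul_smul, sub_add_cancel]
  rw [this]
  exact Submodule.add_mem_sup ⟨_, hsm', rfl⟩ (N₂.smul_mem _ hm₂)

lemma of_injective [IsNoetherianRing R] (f : M →ₗ[R] M') (hf : Function.Injective f)
    (h : FiniteModulo W M') : FiniteModulo W M :=
  of_exact (f := (0 : PUnit →ₗ[R] M)) (g := f)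
    (fun x hx ↦ ⟨0, by rw [map_zero, ← (map_eq_zero_iff f hf).1 hx]⟩) of_finite h

lemma of_surjective [IsNoetherianRing R] (f : M →ₗ[R] M') (hf : Function.Surjective f)
    (h : FiniteModulo W M) : FiniteModulo W M' :=
  of_exact (g := (0 : M' →ₗ[R] PUnit)) (f := f) (fun x _ ↦ hf x) h of_finite

lemma pi [IsNoetherianRing R] (h : FiniteModulo W M) (m : ℕ) : FiniteModulo W (Fin m → M) := by
  induction m with
  | zero => exact of_finite
  | succ m ih =>
    refine of_exact (f := LinearMap.single R (fun _ : Fin (m + 1) ↦ M) 0)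
      (g := LinearMap.funLeft R M Fin.succ) (fun x hx ↦ ⟨x 0, ?_⟩) h ih
    ext i
    refine Fin.cases ?_ (fun i ↦ ?_) i
    · simp
    · simpa using (congrFun hx i).symm

end FiniteModulo

lemma mem_associatedPrimes_iff_exists [IsNoetherianRing R] {M : Type*} [AddCommGroup M] [Module R M]
    {p : Ideal R} : p ∈ associatedPrimes R M ↔ p.IsPrime ∧ ∃ x : M, ∀ r, r ∈ p ↔ r • x = 0 := by
  refine (Submodule.isAssociatedPrime_iff (N := (⊥ : Submodule R M))).trans ?_
  simp only [Ideal.ext_iff, Submodule.mem_colon_singleton, Submodule.mem_bot]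

lemma FiniteModulo.finite_associatedPrimes [IsNoetherianRing R] {M : Type*} [AddCommGroup M]
    [Module R M] (W : Set (PrimeSpectrum R)) (N : Submodule R M) (hN : N.FG) (T : Set M)
    (hT : ∀ p ∈ W, ∀ x ∈ T, ∃ s ∉ p.asIdeal, s • x ∈ N) :
    {p ∈ W | ∃ x ∈ T, ∀ r, r ∈ p.asIdeal ↔ r • x = 0}.Finite := by
  have : Module.Finite R N := Module.Finite.iff_fg.2 hN
  refine ((associatedPrimes.finite R N).preimage
    (fun p _ q _ h ↦ PrimeSpectrum.ext h)).subset ?_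
  rintro p ⟨hp, x, hx, h⟩
  obtain ⟨s, hs, hsx⟩ := hT p hp x hx
  refine mem_associatedPrimes_iff_exists.2 ⟨p.isPrime, ⟨s • x, hsx⟩, fun r ↦ ?_⟩
  rw [← Subtype.coe_inj, Submodule.coe_smul, Submodule.coe_zero, smul_smul, ← h]
  exact ⟨fun hr ↦ Ideal.mul_mem_right _ _ hr, fun hr ↦ (p.isPrime.mem_or_mem hr).resolve_right hs⟩

lemma Module.Injective.exists_extension {E A B : Type u} [AddCommGroup E] [Module R E]
    [AddCommGroup A] [Module R A] [AddCommGroup B] [Module R B] [Module.Injective R E]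
    (g : A →ₗ[R] B) (f : A →ₗ[R] E) (h : LinearMap.ker g ≤ LinearMap.ker f) :
    ∃ e : B →ₗ[R] E, ∀ x, e (g x) = f x := by
  obtain ⟨e, he⟩ := Module.Injective.out (Submodule.liftQ (LinearMap.ker g) g le_rfl)
    (LinearMap.ker_eq_bot.1 (Submodule.ker_liftQ_eq_bot _ _ _ le_rfl))
    (Submodule.liftQ (LinearMap.ker g) f h)
  exact ⟨e, fun x ↦ he (Submodule.Quotient.mk x)⟩

lemma exists_pow_smul_eq_zero_of_fg {N : Type*} [AddCommGroup N] [Module R N] (a : Ideal R)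
    (P : Submodule R N) (hP : P.FG) (h : P ≤ gammaSubmodule a N) :
    ∃ k : ℕ, ∀ c ∈ a ^ k, ∀ x ∈ P, c • x = 0 := by
  obtain ⟨s, rfl⟩ := hP
  choose! k hk using fun x (hx : x ∈ s) ↦ h (Submodule.subset_span hx)
  refine ⟨s.sup k, fun c hc x hx ↦ ?_⟩
  induction hx using Submodule.span_induction with
  | mem x hx => exact hk x hx c (Ideal.pow_le_pow_right (Finset.le_sup hx) hc)
  | zero => exact smul_zero c
  | add x y _ _ hx hy => rw [smul_add, hx, hy, add_zero]
  | smul r x _ hx => rw [smul_comm, hx, smul_zero]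

lemma gammaSubmodule_injective [IsNoetherianRing R] (a : Ideal R) (E : Type u) [AddCommGroup E]
    [Module R E] [Module.Injective R E] : Module.Injective R (gammaSubmodule a E) := by
  refine Module.Baer.injective fun I f ↦ ?_
  obtain ⟨k, hk⟩ := exists_pow_smul_eq_zero_of_fg a
    (LinearMap.range ((gammaSubmodule a E).subtype ∘ₗ f))
    (by rw [LinearMap.range_eq_map]; exact (Module.Finite.fg_top).map _)
    (by rintro _ ⟨x, rfl⟩; exact (f x).2)
  obtain ⟨m, hm⟩ := Ideal.exists_pow_inf_eq_pow_smul a (I : Submodule R R)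
  have hle : a ^ (k + m) • (⊤ : Submodule R R) ⊓ I ≤ a ^ k • I := by
    rw [hm (k + m) (Nat.le_add_left m k), Nat.add_sub_cancel]
    exact Submodule.smul_mono le_rfl inf_le_right
  obtain ⟨e, he⟩ := Module.Injective.exists_extension (E := E)
    ((Submodule.mkQ (a ^ (k + m))) ∘ₗ (Submodule.subtype I))
    ((gammaSubmodule a E).subtype ∘ₗ f) (by
      intro x hx
      have hx' : x.1 ∈ a ^ (k + m) := (Submodule.Quotient.mk_eq_zero _).1 hx
      have hx2 : x.1 ∈ a ^ k • I := hle ⟨by simpa using hx', x.2⟩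
      have hall : ∀ y (hy : y ∈ a ^ k • I) (hyI : y ∈ I),
          ((f ⟨y, hyI⟩ : gammaSubmodule a E) : E) = 0 := by
        intro y hy
        induction hy using Submodule.smul_induction_on' with
        | smul r hr z hz =>
          intro hyI
          have : (⟨r • z, hyI⟩ : I) = r • (⟨z, hz⟩ : I) := rfl
          rw [this, map_smul]
          exact hk r hr _ ⟨⟨z, hz⟩, rfl⟩
        | add y hy z hz ihy ihz =>
          intro hyI
          have : (⟨y + z, hyI⟩ : I) = (⟨y, Submodule.smul_le_right hy⟩ : I) +
            (⟨z, Submodule.smul_le_right hz⟩ : I) := rfl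
          rw [this, map_add, Submodule.coe_add, ihy, ihz, add_zero]
      exact hall _ hx2 x.2)
  have hmem : ∀ x, (e ∘ₗ Submodule.mkQ (a ^ (k + m))) x ∈ gammaSubmodule a E := by
    intro x
    refine ⟨k + m, fun c hc ↦ ?_⟩
    rw [← map_smul, LinearMap.comp_apply]
    have : (Submodule.mkQ (a ^ (k + m))) (c • x) = 0 :=
      (Submodule.Quotient.mk_eq_zero _).2 ((a ^ (k + m)).mul_mem_right x hc)
    rw [this, map_zero]
  refine ⟨LinearMap.codRestrict _ (e ∘ₗ Submodule.mkQ (a ^ (k + m))) hmem, fun x hx ↦ ?_⟩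
  exact Subtype.ext (he ⟨x, hx⟩)
end

end

section
open Limits Opposite Abelian

section
variable {R : Type u} [CommRing R] [IsNoetherianRing R] {W : Set (PrimeSpectrum R)}

lemma FiniteModulo.linearMap (X Y : Type*) [AddCommGroup X] [Module R X] [Module.Finite R X]
    [AddCommGroup Y] [Module R Y] (hY : FiniteModulo W Y) : FiniteModulo W (X →ₗ[R] Y) := by
  obtain ⟨m, x, hx⟩ := Module.Finite.exists_fin (R := R) (M := X)
  exact (hY.pi m).of_injective (LinearMap.pi fun i ↦ LinearMap.applyₗ (x i))
    fun f g h ↦ LinearMap.ext_on_range hx fun i ↦ congrFun h i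

lemma FiniteModulo.ext (X Y : ModuleCat.{u} R) [Module.Finite R X]
    (hY : FiniteModulo W Y) (q : ℕ) : FiniteModulo W (Ext X Y q) := by
  induction q generalizing X with
  | zero =>
    exact (FiniteModulo.linearMap X Y hY).of_injective
      (Ext.linearEquiv₀.trans ModuleCat.homLinearEquiv).toLinearMap (LinearEquiv.injective _)
  | succ q ih =>
    obtain ⟨N, _, _, _, _, f, surjf⟩ := Module.exists_finite_presentation R X
    let exac := LinearMap.shortExact_shortComplexKer surjf
    have : Module.Finite R f.shortComplexKer.X₁ :=
      inferInstanceAs (Module.Finite R (LinearMap.ker f))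
    exact (ih f.shortComplexKer.X₁).of_surjective (exac.extClass.precompOfLinear R Y (add_comm 1 q))
      (precomp_extClass_surjective_of_projective_X₂ Y exac q)

/-- The short complex of an exact pair of linear maps. -/
abbrev linearShortComplex {A B C : Type u} [AddCommGroup A] [Module R A] [AddCommGroup B]
    [Module R B]
    [AddCommGroup C] [Module R C] (f : A →ₗ[R] B) (g : B →ₗ[R] C) (h : Function.Exact f g) :
    ShortComplex (ModuleCat.{u} R) :=
  ShortComplex.mk (ModuleCat.ofHom f) (ModuleCat.ofHom g) (by ext x; exact h.apply_apply_eq_zero x)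

omit [IsNoetherianRing R] in
lemma linearShortComplex_shortExact {A B C : Type u} [AddCommGroup A] [Module R A] [AddCommGroup B]
    [Module R B] [AddCommGroup C] [Module R C] {f : A →ₗ[R] B} {g : B →ₗ[R] C}
    (hf : Function.Injective f) (hg : Function.Surjective g) (h : Function.Exact f g) :
    (linearShortComplex f g h).ShortExact where
  exact := (ShortComplex.ShortExact.moduleCat_exact_iff_function_exact _).2 h
  mono_f := (ModuleCat.mono_iff_injective _).2 hf
  epi_g := (ModuleCat.epi_iff_surjective _).2 hg

section
variable {A B C : ModuleCat.{u} R} {f : A →ₗ[R] B} {g : B →ₗ[R] C}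
    (hf : Function.Injective f) (hg : Function.Surjective g) (h : Function.Exact f g)
    (X : ModuleCat.{u} R) (q : ℕ)
include hf hg h

lemma FiniteModulo.ext_middle (hA : FiniteModulo W (Ext X A q)) (hC : FiniteModulo W (Ext X C q)) :
    FiniteModulo W (Ext X B q) :=
  of_exact (f := (Ext.mk₀ (ModuleCat.ofHom f)).postcompOfLinear R X (add_zero q))
    (g := (Ext.mk₀ (ModuleCat.ofHom g)).postcompOfLinear R X (add_zero q))
    (fun x hx ↦ Ext.covariant_sequence_exact₂ X (linearShortComplex_shortExact hf hg h) x hx) hA hC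

lemma FiniteModulo.ext_right_of_injective [Module.Injective R B]
    (hA : FiniteModulo W (Ext X A (q + 2))) :
    FiniteModulo W (Ext X C (q + 1)) := by
  let hS := linearShortComplex_shortExact hf hg h
  have : Injective B := Module.injective_object_of_injective_module R B
  refine hA.of_injective (hS.extClass.postcompOfLinear R X rfl) ?_
  rw [injective_iff_map_eq_zero]
  intro x hx
  obtain ⟨y, rfl⟩ := Ext.covariant_sequence_exact₃ X hS x rfl hx
  rw [Ext.eq_zero_of_injective (I := B) y]
  exact Ext.zero_comp X _ _ _ _

lemma FiniteModulo.ext_zero_right {H : Type*} [AddCommGroup H] [Module R H]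
    (φ : (X ⟶ B) →ₗ[R] H) (hφ : ∀ u : X ⟶ B, φ u = 0 → u ≫ ModuleCat.ofHom g = 0)
    (hH : FiniteModulo W H) (hA : FiniteModulo W (Ext X A 1)) :
    FiniteModulo W (Ext X C 0) := by
  let hS := linearShortComplex_shortExact hf hg h
  let ψ : (X ⟶ B) →ₗ[R] Ext X C 0 :=
    (Ext.mk₀ (ModuleCat.ofHom g)).postcompOfLinear R X (add_zero 0) ∘ₗ
      Ext.linearEquiv₀.symm.toLinearMap
  have hψ : ∀ u : X ⟶ B, ψ u = Ext.mk₀ (u ≫ ModuleCat.ofHom g) := fun u ↦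
    Ext.mk₀_comp_mk₀ u (ModuleCat.ofHom g)
  have h1 : FiniteModulo W (LinearMap.range φ) :=
    hH.of_injective (LinearMap.range φ).subtype (Submodule.subtype_injective _)
  have h2 : FiniteModulo W (LinearMap.range ψ) := by
    refine h1.of_surjective ((Submodule.liftQ (LinearMap.ker φ) ψ.rangeRestrict ?_) ∘ₗ
      φ.quotKerEquivRange.symm.toLinearMap) ?_
    · intro u hu
      rw [LinearMap.ker_rangeRestrict, LinearMap.mem_ker, hψ, hφ u hu, Ext.mk₀_zero]
    · rw [LinearMap.coe_comp]
      refine Function.Surjective.comp ?_ φ.quotKerEquivRange.symm.surjective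
      rw [← LinearMap.range_eq_top, Submodule.range_liftQ, LinearMap.range_eq_top]
      exact LinearMap.surjective_rangeRestrict ψ
  refine of_exact (f := (LinearMap.range ψ).subtype)
    (g := hS.extClass.postcompOfLinear R X rfl) (fun x hx ↦ ?_) h2 hA
  obtain ⟨y, rfl⟩ := Ext.covariant_sequence_exact₃ X hS x rfl hx
  obtain ⟨u, rfl⟩ := Ext.linearEquiv₀ (R := R).symm.surjective y
  exact ⟨⟨ψ u, u, rfl⟩, rfl⟩
end
end

end

section
open Limits Opposite Abelian

namespace InjectiveChain
variable {R : Type u} [CommRing R] (C : InjectiveChain R) (a : Ideal R)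

/-- `Γ_a(Z i) → Γ_a(E i)`. -/
def gammaι (i : ℕ) : gammaSubmodule a (C.Z i) →ₗ[R] gammaSubmodule a (C.E i) :=
  (C.ι i).restrict fun _ hx ↦ (C.ι i).map_mem_gammaSubmodule hx

/-- `Γ_a(E i) → B (i + 1)`. -/
noncomputable def gammaπ (i : ℕ) : gammaSubmodule a (C.E i) →ₗ[R] C.boundary a (i + 1) :=
  (C.π i).restrict fun _ hx ↦ Submodule.mem_map_of_mem hx

lemma gammaι_injective (i : ℕ) : Function.Injective (C.gammaι a i) := fun _ _ h ↦
  Subtype.ext (C.ι_injective i (congrArg Subtype.val h))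

lemma gammaπ_surjective (i : ℕ) : Function.Surjective (C.gammaπ a i) := by
  rintro ⟨_, x, hx, rfl⟩
  exact ⟨⟨x, hx⟩, rfl⟩

lemma gamma_exact (i : ℕ) : Function.Exact (C.gammaι a i) (C.gammaπ a i) := by
  rintro ⟨x, hx⟩
  refine Subtype.ext_iff.trans ((C.exact i x).trans ⟨?_, ?_⟩)
  · rintro ⟨z, rfl⟩
    obtain ⟨k, hk⟩ := hx
    refine ⟨⟨z, k, fun c hc ↦ C.ι_injective i ?_⟩, rfl⟩
    rw [map_smul, hk c hc, map_zero]
  · rintro ⟨z, hz⟩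
    exact ⟨z.1, congrArg Subtype.val hz⟩

lemma boundary_le (i : ℕ) : C.boundary a i ≤ gammaSubmodule a (C.Z i) := by
  cases i with
  | zero => exact bot_le
  | succ i =>
    rintro _ ⟨x, hx, rfl⟩
    exact (C.π i).map_mem_gammaSubmodule hx

/-- Local cohomology as `Γ_a(Z i) / B i`. -/
noncomputable def toLocalCohomology (i : ℕ) :
    gammaSubmodule a (C.Z i) →ₗ[R] ((localCohomology a i).obj (C.Z 0)) :=
  (C.exists_gammaToLocalCohomology a i).choose

lemma toLocalCohomology_surjective (i : ℕ) : Function.Surjective (C.toLocalCohomology a i) :=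
  (C.exists_gammaToLocalCohomology a i).choose_spec.1

lemma toLocalCohomology_eq_zero_iff {i : ℕ} {x : gammaSubmodule a (C.Z i)} :
    C.toLocalCohomology a i x = 0 ↔ x.1 ∈ C.boundary a i :=
  (C.exists_gammaToLocalCohomology a i).choose_spec.2 x

lemma toLocalCohomology_exact (i : ℕ) :
    Function.Exact (Submodule.inclusion (C.boundary_le a i)) (C.toLocalCohomology a i) := by
  intro x
  rw [toLocalCohomology_eq_zero_iff]
  exact ⟨fun h ↦ ⟨⟨x, h⟩, rfl⟩, by rintro ⟨y, rfl⟩; exact y.2⟩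

variable [IsNoetherianRing R] {W : Set (PrimeSpectrum R)}

variable {a}

lemma finiteModulo_ext_boundary (X : ModuleCat.{u} R) [Module.Finite R X] (j : ℕ)
    (hL : ∀ i < j, FiniteModulo W ((localCohomology a i).obj (C.Z 0))) (q : ℕ) :
    FiniteModulo W (Ext X (ModuleCat.of R (C.boundary a j)) (q + 1)) := by
  induction j generalizing q with
  | zero =>
    refine FiniteModulo.ext X _ ?_ _
    have : Module.Finite R (C.boundary a 0) := Module.Finite.iff_fg.2 Submodule.fg_bot
    exact FiniteModulo.of_finite (M := C.boundary a 0)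
  | succ j ih =>
    have : Module.Injective R (ModuleCat.of R (gammaSubmodule a (C.E j))) :=
      have := C.injective j
      gammaSubmodule_injective a (C.E j)
    refine FiniteModulo.ext_right_of_injective
      (A := ModuleCat.of R (gammaSubmodule a (C.Z j)))
      (B := ModuleCat.of R (gammaSubmodule a (C.E j)))
      (C := ModuleCat.of R (C.boundary a (j + 1)))
      (C.gammaι_injective a j) (C.gammaπ_surjective a j) (C.gamma_exact a j) X q ?_
    exact FiniteModulo.ext_middle (A := ModuleCat.of R (C.boundary a j))
      (B := ModuleCat.of R (gammaSubmodule a (C.Z j))) (Submodule.inclusion_injective _)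
      (C.toLocalCohomology_surjective a j) (C.toLocalCohomology_exact a j) X (q + 2)
      (ih (fun i hi ↦ hL i (by lia)) (q + 1))
      (FiniteModulo.ext X _ (hL j (by lia)) _)

/-- `Hom(R ⧸ a ^ k, H^j_a)` is finite modulo `W` if the lower local cohomologies are. -/
theorem finiteModulo_ext_localCohomology (k j : ℕ) (h₀ : FiniteModulo W (C.Z 0))
    (hL : ∀ i < j, FiniteModulo W ((localCohomology a i).obj (C.Z 0))) :
    FiniteModulo W (Ext (ModuleCat.of R (R ⧸ a ^ k)) ((localCohomology a j).obj (C.Z 0)) 0) := by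
  let φ : (ModuleCat.of R (R ⧸ a ^ k) ⟶ ModuleCat.of R (gammaSubmodule a (C.Z j))) →ₗ[R]
      Ext (ModuleCat.of R (R ⧸ a ^ k)) (C.Z 0) j :=
    C.homToExt _ j ∘ₗ Linear.rightComp R _ (ModuleCat.ofHom (gammaSubmodule a (C.Z j)).subtype)
  refine FiniteModulo.ext_zero_right (A := ModuleCat.of R (C.boundary a j))
      (B := ModuleCat.of R (gammaSubmodule a (C.Z j))) (Submodule.inclusion_injective _)
      (C.toLocalCohomology_surjective a j) (C.toLocalCohomology_exact a j) _ φ (fun u hu ↦ ?_)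
      (FiniteModulo.ext _ _ h₀ j) (C.finiteModulo_ext_boundary _ j hL 0)
  refine hom_quot_pow_ext ?_
  have := (C.homToExt_eq_zero_iff_of_quot_pow a j k
    (u ≫ (ModuleCat.ofHom (gammaSubmodule a (C.Z j)).subtype))).1
    ⟨k, le_rfl, by
      rw [homToExt_comp]
      refine (congrArg (fun z ↦ (Ext.mk₀ (localCohomology.quotPowMap a (le_refl k))).comp z
        (zero_add j)) hu).trans ?_
      exact Ext.comp_zero (Ext.mk₀ (localCohomology.quotPowMap a (le_refl k))) (C.Z 0) j j _⟩
  exact (C.toLocalCohomology_eq_zero_iff a).2 this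

theorem exists_fg_smul_mem (k j : ℕ) (h₀ : FiniteModulo W (C.Z 0))
    (hL : ∀ i < j, FiniteModulo W ((localCohomology a i).obj (C.Z 0))) :
    ∃ N : Submodule R ((localCohomology a j).obj (C.Z 0)), N.FG ∧ ∀ p ∈ W,
      ∀ x ∈ {x : ((localCohomology a j).obj (C.Z 0)) | ∀ c ∈ a ^ k, c • x = 0},
        ∃ s ∉ p.asIdeal, s • x ∈ N := by
  obtain ⟨N, hN, h⟩ := C.finiteModulo_ext_localCohomology k j h₀ hL
  let ev : Ext (ModuleCat.of R (R ⧸ a ^ k)) ((localCohomology a j).obj (C.Z 0)) 0 →ₗ[R]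
    ((localCohomology a j).obj (C.Z 0)) := LinearMap.applyₗ (1 : R ⧸ a ^ k) ∘ₗ
      (Ext.linearEquiv₀.trans ModuleCat.homLinearEquiv).toLinearMap
  refine ⟨N.map ev, hN.map ev, fun p hp x hx ↦ ?_⟩
  obtain ⟨f, hf⟩ := exists_hom_quot_pow hx
  obtain ⟨s, hs, hsf⟩ := h p hp (Ext.linearEquiv₀ (R := R).symm f)
  refine ⟨s, hs, _, hsf, ?_⟩
  rw [map_smul]
  congr 1
  refine Eq.trans ?_ hf
  change (Ext.linearEquiv₀ (R := R) (Ext.linearEquiv₀ (R := R).symm f)) (1 : R ⧸ a ^ k) = _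
  rw [LinearEquiv.apply_symm_apply]

end InjectiveChain

end

section
open Limits Opposite Abelian

section
variable {R : Type u} [CommRing R] (S : Submonoid R)

lemma LocalizedModule.algebraMap_smul_mk {N : Type*} [AddCommGroup N] [Module R N] (c : R)
    (z : N) (s : S) :
    algebraMap R (Localization S) c • LocalizedModule.mk z s = LocalizedModule.mk (c • z) s := by
  rw [algebraMap_smul, LocalizedModule.smul'_mk]

lemma mk_mem_gammaSubmodule {N : Type*} [AddCommGroup N] [Module R N] {a : Ideal R} {z : N}
    (hz : z ∈ gammaSubmodule a N) (s : S) :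
    LocalizedModule.mk z s ∈ gammaSubmodule (a.map (algebraMap R (Localization S)))
      (LocalizedModule S N) := by
  obtain ⟨k, hk⟩ := hz
  refine ⟨k, fun c hc ↦ ?_⟩
  rw [← Ideal.map_pow] at hc
  induction hc using Submodule.span_induction with
  | mem c hc =>
    obtain ⟨d, hd, rfl⟩ := hc
    refine (LocalizedModule.algebraMap_smul_mk S d z s).trans ?_
    rw [hk d hd, LocalizedModule.zero_mk]
  | zero => exact zero_smul _ _
  | add x y _ _ hx hy => rw [add_smul, hx, hy, add_zero]
  | smul r x _ hx => rw [smul_assoc, hx, smul_zero]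

/-- Elements of `S` annihilating `c • e` for each `c` in a finitely generated ideal can be chosen
uniformly. -/
lemma exists_smul_eq_zero_of_fg {N : Type*} [AddCommGroup N] [Module R N] {I : Ideal R}
    (hI : I.FG) {e : N} (h : ∀ c ∈ I, ∃ u ∈ S, u • c • e = 0) :
    ∃ u ∈ S, ∀ c ∈ I, c • u • e = 0 := by
  obtain ⟨t, rfl⟩ := hI
  choose! u hu hue using fun c (hc : c ∈ t) ↦ h c (Submodule.subset_span hc)
  refine ⟨∏ c ∈ t, u c, S.prod_mem hu, fun c hc ↦ ?_⟩
  induction hc using Submodule.span_induction with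
  | mem c hc =>
    obtain ⟨d, hd⟩ := Finset.dvd_prod_of_mem u hc
    rw [hd, mul_comm, mul_smul, smul_comm, smul_comm c, hue c hc, smul_zero]
  | zero => exact zero_smul _ _
  | add x y _ _ hx hy => rw [add_smul, hx, hy, add_zero]
  | smul r x _ hx => rw [smul_assoc, hx, smul_zero]

lemma exists_smul_mem_gammaSubmodule [IsNoetherianRing R] {N : Type*} [AddCommGroup N] [Module R N]
    {a : Ideal R} {e : N} {s : S}
    (he : LocalizedModule.mk e s ∈ gammaSubmodule (a.map (algebraMap R (Localization S)))
      (LocalizedModule S N)) :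
    ∃ u ∈ S, u • e ∈ gammaSubmodule a N := by
  obtain ⟨k, hk⟩ := he
  obtain ⟨u, hu, h⟩ := exists_smul_eq_zero_of_fg S (e := e) (IsNoetherian.noetherian (a ^ k))
    fun c hc ↦ by
      have := hk (algebraMap R (Localization S) c)
        (by rw [← Ideal.map_pow]; exact Ideal.mem_map_of_mem _ hc)
      rw [LocalizedModule.algebraMap_smul_mk, ← LocalizedModule.zero_mk s,
        LocalizedModule.mk_eq] at this
      obtain ⟨u, hu⟩ := this
      have hu' : (u : R) • (s : R) • c • e = (u : R) • (s : R) • (0 : N) := hu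
      exact ⟨u * s, S.mul_mem u.2 s.2, by rw [mul_smul, hu', smul_zero, smul_zero]⟩
  exact ⟨u, hu, k, h⟩
end

namespace InjectiveChain
variable {R : Type u} [CommRing R] [IsNoetherianRing R] (C : InjectiveChain R) (a : Ideal R)
  (S : Submonoid R)

/-- The localization of an injective chain. -/
noncomputable def localize : InjectiveChain (Localization S) where
  Z i := ModuleCat.of _ (LocalizedModule S (C.Z i))
  E i := ModuleCat.of _ (LocalizedModule S (C.E i))
  ι i := LocalizedModule.map S (C.ι i)
  π i := LocalizedModule.map S (C.π i)
  ι_injective i := LocalizedModule.map_injective S _ (C.ι_injective i)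
  π_surjective i := LocalizedModule.map_surjective S _ (C.π_surjective i)
  exact i := LocalizedModule.map_exact S _ _ (C.exact i)
  injective i :=
    have := C.injective i
    Module.injective_of_isLocalizedModule (Rₛ := Localization S) S
      (LocalizedModule.mkLinearMap S (C.E i))

lemma exists_smul_mem_boundary (i : ℕ) {z : C.Z i} {s : S}
    (h : (LocalizedModule.mk z s : LocalizedModule S (C.Z i)) ∈
      (C.localize S).boundary (a.map (algebraMap R (Localization S))) i) :
    ∃ u ∈ S, u • z ∈ C.boundary a i := by
  cases i with
  | zero =>
    have h0 : (LocalizedModule.mk z s : LocalizedModule S (C.Z 0)) = 0 := h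
    rw [← LocalizedModule.zero_mk s, LocalizedModule.mk_eq] at h0
    obtain ⟨u, hu⟩ := h0
    refine ⟨u * s, S.mul_mem u.2 s.2, ?_⟩
    have hu' : (u : R) • (s : R) • z = (u : R) • (s : R) • (0 : C.Z 0) := hu
    have : (u * s : R) • z = 0 := by rw [mul_smul, hu', smul_zero, smul_zero]
    rw [this]
    exact Submodule.zero_mem _
  | succ i =>
    obtain ⟨e', he', hz⟩ := h
    obtain ⟨⟨e, v⟩, rfl⟩ : ∃ x : C.E i × S, LocalizedModule.mk x.1 x.2 = e' := by
      induction e' using LocalizedModule.induction_on with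
      | _ e v => exact ⟨(e, v), rfl⟩
    obtain ⟨u, hu, hue⟩ := exists_smul_mem_gammaSubmodule S he'
    have hz' : LocalizedModule.mk (C.π i e) v = LocalizedModule.mk z s :=
      (LocalizedModule.map_mk S (C.π i) e v).symm.trans hz
    obtain ⟨w, hw⟩ := LocalizedModule.mk_eq.1 hz'
    refine ⟨u * (w * v), S.mul_mem hu (S.mul_mem w.2 v.2), (w * s : R) • u • e,
      Submodule.smul_mem _ _ hue, ?_⟩
    have hw' : (w : R) • (s : R) • C.π i e = (w : R) • (v : R) • z := hw
    rw [map_smul, map_smul, smul_comm, mul_smul, hw', mul_smul, mul_smul]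

/-- If the local cohomology of the localization is finitely generated, then some power of `a`
annihilates the localized local cohomology. -/
theorem exists_pow_smul_eq_zero_of_localize_finite (i : ℕ)
    (h : Module.Finite (Localization S) ((localCohomology
      (a.map (algebraMap R (Localization S))) i).obj ((C.localize S).Z 0))) :
    ∃ k : ℕ, ∀ x : (localCohomology a i).obj (C.Z 0), ∀ c ∈ a ^ k, ∃ s ∈ S, s • c • x = 0 := by
  obtain ⟨k, hk⟩ := exists_pow_smul_eq_zero_of_fg (a.map (algebraMap R (Localization S)))
    (⊤ : Submodule _ ((localCohomology
      (a.map (algebraMap R (Localization S))) i).obj ((C.localize S).Z 0))) Module.Finite.fg_top (by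
      intro y _
      obtain ⟨x, rfl⟩ := (C.localize S).toLocalCohomology_surjective _ i y
      refine LinearMap.map_mem_gammaSubmodule _ ?_
      obtain ⟨k, hk⟩ := x.2
      exact ⟨k, fun c hc ↦ Subtype.ext (hk c hc)⟩)
  refine ⟨k, fun x c hc ↦ ?_⟩
  obtain ⟨z, rfl⟩ := C.toLocalCohomology_surjective a i x
  have h1 := hk (algebraMap R (Localization S) c)
    (by rw [← Ideal.map_pow]; exact Ideal.mem_map_of_mem _ hc)
    ((C.localize S).toLocalCohomology _ i ⟨_, mk_mem_gammaSubmodule S z.2 1⟩) trivial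
  rw [← map_smul, toLocalCohomology_eq_zero_iff] at h1
  have h2 : (LocalizedModule.mk (c • z.1) 1 : LocalizedModule S (C.Z i)) ∈
      (C.localize S).boundary (a.map (algebraMap R (Localization S))) i :=
    Set.mem_of_eq_of_mem (LocalizedModule.algebraMap_smul_mk S c z.1 1).symm h1
  obtain ⟨u, hu, h3⟩ := C.exists_smul_mem_boundary a S i h2
  refine ⟨u, hu, ?_⟩
  rw [← map_smul, ← map_smul, toLocalCohomology_eq_zero_iff]
  exact h3

end InjectiveChain

section
variable {R : Type u} [CommRing R] (a : Ideal R)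

lemma localCohomology.subsingleton_of_subsingleton (Y : ModuleCat.{u} R) [Subsingleton Y] (n : ℕ) :
    Subsingleton ((localCohomology a n).obj Y) := by
  obtain ⟨J, -, hJ, -⟩ := localCohomology.exists_oldExt a n Y
  refine subsingleton_of_forall_eq 0 fun y ↦ ?_
  obtain ⟨k, x, rfl⟩ := hJ y
  have hx : x = 0 := by
    obtain ⟨f, rfl⟩ := cocyclesToOldExt_surjective
      (ProjectiveResolution.of (ModuleCat.of R (R ⧸ a ^ k))) Y n x
    have hf : f = 0 := Subtype.ext (ModuleCat.hom_ext (LinearMap.ext fun _ ↦ Subsingleton.elim _ _))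
    rw [hf, map_zero]
  rw [hx, map_zero]
end

end

section
variable {R : Type u} [CommRing R] {a : Ideal R}

lemma mem_gammaSubmodule_localCohomology (M : ModuleCat.{u} R) (i : ℕ)
    (x : (localCohomology a i).obj M) : x ∈ gammaSubmodule a ((localCohomology a i).obj M) := by
  obtain ⟨z, rfl⟩ := (InjectiveChain.ofModule M).toLocalCohomology_surjective a i x
  refine LinearMap.map_mem_gammaSubmodule _ ?_
  obtain ⟨k, hk⟩ := z.2
  exact ⟨k, fun c hc ↦ Subtype.ext (hk c hc)⟩

lemma le_of_forall_mem_iff_smul_eq_zero {N : Type*} [AddCommGroup N] [Module R N]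
    {x : N} (hx : x ∈ gammaSubmodule a N) {p : Ideal R} (hp : p.IsPrime)
    (h : ∀ r, r ∈ p ↔ r • x = 0) : a ≤ p := by
  obtain ⟨k, hk⟩ := hx
  exact fun c hc ↦ hp.mem_of_pow_mem k ((h _).2 (hk _ (Ideal.pow_mem_pow hc k)))

variable [IsNoetherianRing R]

lemma exists_pow_smul_eq_zero_of_le_fDimN {M : Type u} [AddCommGroup M] [Module R M]
    [Module.Finite R M] {n t : ℕ} (ht : (t : ℕ∞) ≤ fDimN R a M n) {p : PrimeSpectrum R}
    (hp : (n : WithBot ℕ∞) ≤ ringKrullDim (R ⧸ p.asIdeal)) (hap : a ≤ p.asIdeal)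
    {i : ℕ} (hi : i < t) :
    ∃ k : ℕ, ∀ x : (localCohomology a i).obj (ModuleCat.of R M), ∀ c ∈ a ^ k,
      ∃ s ∉ p.asIdeal, s • c • x = 0 := by
  refine (InjectiveChain.ofModule (ModuleCat.of R M)).exists_pow_smul_eq_zero_of_localize_finite a
    p.asIdeal.primeCompl i ?_
  by_cases hM : p ∈ Module.support R M
  · by_contra h
    refine hi.not_ge ?_
    rw [← Nat.cast_le (α := ℕ∞)]
    have hp' : p ∈ Module.support R (M ⧸ (a • ⊤ : Submodule R M)) := by
      rw [Module.support_quotient]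
      exact ⟨hM, hap⟩
    rw [fDimN] at ht
    refine ht.trans ((sInf_le (Set.mem_ofPred.2 ⟨p, hp', hp, rfl⟩)).trans ?_)
    rw [fDim]
    exact sInf_le (Set.mem_ofPred.2 ⟨i, rfl, h⟩)
  · have : Subsingleton (LocalizedModule p.asIdeal.primeCompl M) := Module.notMem_support_iff.1 hM
    have : Subsingleton (((InjectiveChain.ofModule (ModuleCat.of R M)).localize
      p.asIdeal.primeCompl).Z 0) := this
    have := localCohomology.subsingleton_of_subsingleton
      (a.map (algebraMap R (Localization p.asIdeal.primeCompl)))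
      (((InjectiveChain.ofModule (ModuleCat.of R M)).localize p.asIdeal.primeCompl).Z 0) i
    infer_instance

/-- An element vanishes locally at all primes of a generization-stable set `W` if it vanishes at
the associated primes of the module lying in `W`. -/
lemma exists_smul_eq_zero_of_associatedPrimes {N : Type*} [AddCommGroup N] [Module R N]
    {W : Set (PrimeSpectrum R)} (hW : ∀ p ∈ W, ∀ q ≤ p, q ∈ W) {y : N}
    (h : ∀ q ∈ W, q.asIdeal ∈ associatedPrimes R N → ∃ s ∉ q.asIdeal, s • y = 0) :
    ∀ p ∈ W, ∃ s ∉ p.asIdeal, s • y = 0 := by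
  intro p hp
  by_contra! hc
  have hle : (⊥ : Submodule R N).colon {y} ≤ p.asIdeal := fun r hr ↦ by
    by_contra hrp
    exact hc r hrp (Submodule.mem_colon_singleton.1 hr)
  have := p.isPrime
  obtain ⟨q, hq, hqp⟩ := Ideal.exists_minimalPrimes_le hle
  obtain ⟨x', hx'⟩ := Submodule.exists_eq_colon_of_mem_minimalPrimes hq
  obtain ⟨s, hs, hsy⟩ := h ⟨q, hq.1.1⟩ (hW p hp _ hqp)
    (mem_associatedPrimes_iff_exists.2 ⟨hq.1.1, x', fun r ↦
      (Ideal.ext_iff.1 hx' r).trans Submodule.mem_colon_singleton⟩)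
  exact hs (hq.1.2 (Submodule.mem_colon_singleton.2 hsy))

variable {W : Set (PrimeSpectrum R)} {M : Type u} [AddCommGroup M] [Module R M]
  [Module.Finite R M]

lemma finite_associatedPrimes_localCohomology (j : ℕ)
    (hL : ∀ i < j, FiniteModulo W ((localCohomology a i).obj (ModuleCat.of R M))) :
    {p ∈ W | p.asIdeal ∈ associatedPrimes R
      ((localCohomology a j).obj (ModuleCat.of R M))}.Finite := by
  have h₀ : FiniteModulo W M := .of_finite
  obtain ⟨N, hN, h⟩ := (InjectiveChain.ofModule (ModuleCat.of R M)).exists_fg_smul_mem (a := a) 1 j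
    h₀ hL
  refine (FiniteModulo.finite_associatedPrimes W N hN _ h).subset ?_
  rintro p ⟨hp, hass⟩
  obtain ⟨-, x, hx⟩ := mem_associatedPrimes_iff_exists.1 hass
  refine ⟨hp, x, fun c hc ↦ (hx c).1 ?_, hx⟩
  exact le_of_forall_mem_iff_smul_eq_zero (mem_gammaSubmodule_localCohomology _ _ x) p.isPrime hx
    (by rwa [pow_one] at hc)

/-- Below a degree in which suitable powers of `a` annihilate the localized local cohomology,
local cohomology is finite modulo a generization-stable set of primes. -/
theorem finiteModulo_localCohomology (hW : ∀ p ∈ W, ∀ q ≤ p, q ∈ W) (t : ℕ)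
    (h : ∀ p ∈ W, a ≤ p.asIdeal → ∀ i < t, ∃ k : ℕ,
      ∀ x : (localCohomology a i).obj (ModuleCat.of R M), ∀ c ∈ a ^ k,
        ∃ s ∉ p.asIdeal, s • c • x = 0) (j : ℕ) (hj : j < t) :
    FiniteModulo W ((localCohomology a j).obj (ModuleCat.of R M)) := by
  induction j using Nat.strong_induction_on with
  | _ j ih =>
  have hL : ∀ i < j, FiniteModulo W ((localCohomology a i).obj (ModuleCat.of R M)) :=
    fun i hi ↦ ih i hi (hi.trans hj)
  have hT := finite_associatedPrimes_localCohomology j hL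
  choose! k hk using fun p hp hap ↦ h p hp hap j hj
  have h₀ : FiniteModulo W M := .of_finite
  obtain ⟨N, hN, hNk⟩ := (InjectiveChain.ofModule (ModuleCat.of R M)).exists_fg_smul_mem (a := a)
    (hT.toFinset.sup k) j h₀ hL
  refine ⟨N, hN, fun p hp x ↦ ?_⟩
  have hloc : ∀ c ∈ a ^ hT.toFinset.sup k, ∃ s ∉ p.asIdeal, s • c • x = 0 := by
    intro c hc
    refine exists_smul_eq_zero_of_associatedPrimes hW (fun q hq hass ↦ ?_) p hp
    obtain ⟨-, y, hy⟩ := mem_associatedPrimes_iff_exists.1 hass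
    refine hk q hq (le_of_forall_mem_iff_smul_eq_zero
      (mem_gammaSubmodule_localCohomology _ _ y) q.isPrime hy) x c (Ideal.pow_le_pow_right ?_ hc)
    exact Finset.le_sup (hT.mem_toFinset.2 ⟨hq, hass⟩)
  obtain ⟨u, hu, hux⟩ := exists_smul_eq_zero_of_fg p.asIdeal.primeCompl
    (IsNoetherian.noetherian (a ^ hT.toFinset.sup k)) hloc
  obtain ⟨v, hv, hvx⟩ := hNk p hp (u • x) hux
  exact ⟨v * u, p.asIdeal.primeCompl.mul_mem hv hu, by rwa [mul_smul]⟩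

lemma exists_mem_associatedPrimes_of_directSum {ι : Type*} [Fintype ι] (N : ι → Type*)
    [∀ i, AddCommGroup (N i)] [∀ i, Module R (N i)] {p : Ideal R}
    (h : p ∈ associatedPrimes R (DirectSum ι N)) : ∃ i, p ∈ associatedPrimes R (N i) := by
  obtain ⟨hp, x, hx⟩ := mem_associatedPrimes_iff_exists.1 h
  have hinf : (Finset.univ.inf fun i ↦ (⊥ : Submodule R (N i)).colon {x i}) = p := by
    ext r
    simp only [Submodule.mem_finsetInf, Finset.mem_univ, true_imp_iff,
      Submodule.mem_colon_singleton, Submodule.mem_bot, hx]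
    exact ⟨fun H ↦ DFinsupp.ext H, fun H i ↦ DFunLike.congr_fun H i⟩
  obtain ⟨i, -, hi⟩ := (hp.inf_le').1 hinf.le
  refine ⟨i, mem_associatedPrimes_iff_exists.2 ⟨hp, x i, fun r ↦ ⟨fun hr ↦ ?_, fun hr ↦ hi ?_⟩⟩⟩
  · exact DFunLike.congr_fun ((hx r).1 hr) i
  · exact Submodule.mem_colon_singleton.2 hr

end

open DirectSum in
theorem assPrimes_directSum_le_finite (R M : Type u) [CommRing R] [IsNoetherianRing R]
    [IsLocalRing R] [IsAdicComplete (IsLocalRing.maximalIdeal R) R]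
    [AddCommGroup M] [Module R M] [Module.Finite R M] (a : Ideal R) (n t : ℕ)
    (ht : fDimN R a M n = (t : ℕ∞)) :
    {p ∈ associatedPrimes R (⨁ i : Fin (t + 1), ((localCohomology a i.1).obj (ModuleCat.of R M))) |
      (n : WithBot ℕ∞) ≤ ringKrullDim (R ⧸ p)}.Finite ∧
    {p ∈ associatedPrimes R ((localCohomology a t).obj (ModuleCat.of R M)) |
      (n : WithBot ℕ∞) ≤ ringKrullDim (R ⧸ p)}.Finite := by
  let W : Set (PrimeSpectrum R) := {p | (n : WithBot ℕ∞) ≤ ringKrullDim (R ⧸ p.asIdeal)}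
  have hW : ∀ p ∈ W, ∀ q ≤ p, q ∈ W := fun p hp q hqp ↦ le_trans (show _ ≤ _ from hp)
    (ringKrullDim_le_of_surjective (Ideal.Quotient.factor hqp)
      (Ideal.Quotient.factor_surjective hqp))
  have hfin : ∀ j ≤ t, {p ∈ associatedPrimes R ((localCohomology a j).obj (ModuleCat.of R M)) |
      (n : WithBot ℕ∞) ≤ ringKrullDim (R ⧸ p)}.Finite := by
    intro j hj
    refine ((finite_associatedPrimes_localCohomology (W := W) (a := a) (M := M) j fun i hi ↦
      finiteModulo_localCohomology hW t (fun p hp hap i hi ↦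
        exists_pow_smul_eq_zero_of_le_fDimN ht.ge hp hap hi) i (hi.trans_le hj)).image
          PrimeSpectrum.asIdeal).subset ?_
    rintro p ⟨hass, hp⟩
    exact ⟨⟨p, hass.1⟩, ⟨hp, hass⟩, rfl⟩
  refine ⟨(Set.finite_iUnion fun i : Fin (t + 1) ↦ hfin i (Nat.lt_succ_iff.1 i.2)).subset ?_,
    hfin t le_rfl⟩
  rintro p ⟨hass, hp⟩
  obtain ⟨i, hi⟩ := exists_mem_associatedPrimes_of_directSum _ hass
  exact Set.mem_iUnion.2 ⟨i, hi, hp⟩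
end
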